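/- Let 𝒯 be a regular T-mesh with V⁺ crossing vertices and E interior l-edges, and suppose V⁺ > 0. Then dim S̄(2,2,1,1,𝒯) ≥ V⁺ − E + 1. -/

import Mathlib

open Filter Set MeasureTheory
open scoped Topology

noncomputable section

/-- A closed axis-aligned rectangle with positive side lengths. -/
structure Rect where
  xmin : ℝ
  xmax : ℝ
  ymin : ℝ
  ymax : ℝ
  hx : xmin < xmax
  hy : ymin < ymax

/-- The set of points of a rectangle. -/
def Rect.toSet (c : Rect) : Set (ℝ × ℝ) :=
  Set.Icc c.xmin c.xmax ×ˢ Set.Icc c.ymin c.ymax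

/-- A regular T-mesh: finitely many cells (closed axis-aligned rectangles) with pairwise
disjoint interiors whose union is a closed axis-aligned rectangle. -/
structure TMesh where
  cells : Set Rect
  outer : Rect
  finite_cells : cells.Finite
  pairwise_disjoint : cells.Pairwise fun c d => Disjoint (interior c.toSet) (interior d.toSet)
  union_eq : (⋃ c ∈ cells, c.toSet) = outer.toSet

/-- The region occupied by a T-mesh. -/
def TMesh.Omega (T : TMesh) : Set (ℝ × ℝ) := T.outer.toSet

/-- The edge skeleton of a T-mesh: the union of the boundaries of all cells. -/
def TMesh.skeleton (T : TMesh) : Set (ℝ × ℝ) := ⋃ c ∈ T.cells, frontier c.toSet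

/-- A vertex of the mesh: a corner of some cell. -/
def IsVertexOf (T : TMesh) (p : ℝ × ℝ) : Prop :=
  ∃ c ∈ T.cells, (p.1 = c.xmin ∨ p.1 = c.xmax) ∧ (p.2 = c.ymin ∨ p.2 = c.ymax)

/-- A crossing vertex: an interior vertex from which four small axis-parallel segments
stay inside the edge skeleton. -/
def IsCrossingVertex (T : TMesh) (p : ℝ × ℝ) : Prop :=
  IsVertexOf T p ∧ p ∈ interior T.Omega ∧
    ∃ ε > (0 : ℝ), segment ℝ p (p + (ε, 0)) ⊆ T.skeleton ∧
      segment ℝ p (p - (ε, 0)) ⊆ T.skeleton ∧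
      segment ℝ p (p + (0, ε)) ⊆ T.skeleton ∧
      segment ℝ p (p - (0, ε)) ⊆ T.skeleton

/-- A horizontal closed segment of positive length. -/
def IsHorizSeg (s : Set (ℝ × ℝ)) : Prop :=
  ∃ a b y : ℝ, a < b ∧ s = Set.Icc a b ×ˢ ({y} : Set ℝ)

/-- A vertical closed segment of positive length. -/
def IsVertSeg (s : Set (ℝ × ℝ)) : Prop :=
  ∃ x a b : ℝ, a < b ∧ s = ({x} : Set ℝ) ×ˢ Set.Icc a b

/-- An l-edge: a maximal axis-parallel closed segment of positive length contained in the
edge skeleton. -/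
def IsLEdge (T : TMesh) (s : Set (ℝ × ℝ)) : Prop :=
  (IsHorizSeg s ∨ IsVertSeg s) ∧ s ⊆ T.skeleton ∧
    ∀ s', (IsHorizSeg s' ∨ IsVertSeg s') → s' ⊆ T.skeleton → s ⊆ s' → s' = s

def IsBoundaryLEdge (T : TMesh) (s : Set (ℝ × ℝ)) : Prop :=
  IsLEdge T s ∧ s ⊆ frontier T.Omega

def IsInteriorLEdge (T : TMesh) (s : Set (ℝ × ℝ)) : Prop :=
  IsLEdge T s ∧ ¬ s ⊆ frontier T.Omega

/-- There is a horizontal l-edge with endpoints `(a,y)`, `(b,y)`. -/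
def HorizLEdgeAt (T : TMesh) (a b y : ℝ) : Prop :=
  a < b ∧ IsLEdge T (Set.Icc a b ×ˢ ({y} : Set ℝ))

/-- The number `V⁺` of crossing vertices. -/
def crossingCount (T : TMesh) : ℕ := {p | IsCrossingVertex T p}.ncard

/-- The number `E` of interior l-edges. -/
def interiorLEdgeCount (T : TMesh) : ℕ := {s | IsInteriorLEdge T s}.ncard

/-- The number `F` of cells. -/
def cellCount (T : TMesh) : ℕ := T.cells.ncard

/-! Partial derivatives (within a set) and smoothness. -/

def pdXW (S : Set (ℝ × ℝ)) (f : ℝ × ℝ → ℝ) : ℝ × ℝ → ℝ :=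
  fun p => derivWithin (fun x => f (x, p.2)) {x | (x, p.2) ∈ S} p.1

def pdYW (S : Set (ℝ × ℝ)) (f : ℝ × ℝ → ℝ) : ℝ × ℝ → ℝ :=
  fun p => derivWithin (fun y => f (p.1, y)) {y | (p.1, y) ∈ S} p.2

/-- The mixed partial derivative `∂^{i+j} f/∂x^i∂y^j`, taken within the set `S`. -/
def mpW (S : Set (ℝ × ℝ)) (i j : ℕ) (f : ℝ × ℝ → ℝ) : ℝ × ℝ → ℝ :=
  (pdYW S)^[j] ((pdXW S)^[i] f)

/-- `f` has continuous mixed partials `∂^{i+j}f/∂x^i∂y^j` on `S` for all `0 ≤ i ≤ α`,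
`0 ≤ j ≤ β` (smoothness indices `α, β ∈ ℤ` may be `-1`, in which case nothing is required
in that variable). -/
def SmoothWithin (S : Set (ℝ × ℝ)) (α β : ℤ) (f : ℝ × ℝ → ℝ) : Prop :=
  (∀ i j : ℕ, (i : ℤ) ≤ α → (j : ℤ) ≤ β → ContinuousOn (mpW S i j f) S) ∧
  (∀ i : ℕ, (i : ℤ) < α → ∀ p ∈ S,
    HasDerivWithinAt (fun x => (pdXW S)^[i] f (x, p.2)) ((pdXW S)^[i+1] f p)
      {x | (x, p.2) ∈ S} p.1) ∧
  (∀ i j : ℕ, (i : ℤ) ≤ α → (j : ℤ) < β → ∀ p ∈ S,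
    HasDerivWithinAt (fun y => mpW S i j f (p.1, y)) (mpW S i (j+1) f p)
      {y | (p.1, y) ∈ S} p.2)

/-- `f` agrees on each cell of `T` with a polynomial of bidegree at most `(m,n)`. -/
def PiecewisePoly (m n : ℕ) (T : TMesh) (f : ℝ × ℝ → ℝ) : Prop :=
  ∀ c ∈ T.cells, ∃ p : MvPolynomial (Fin 2) ℝ,
    p.degreeOf 0 ≤ m ∧ p.degreeOf 1 ≤ n ∧
    ∀ q ∈ c.toSet, f q = MvPolynomial.eval ![q.1, q.2] p

/-- The spline space with homogeneous boundary conditions `S̄(m,n,α,β,T)`. -/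
def SBar (m n : ℕ) (α β : ℤ) (T : TMesh) : Set (ℝ × ℝ → ℝ) :=
  {f | (∀ p, p ∉ T.Omega → f p = 0) ∧ PiecewisePoly m n T f ∧ SmoothWithin Set.univ α β f}

/-- The spline space `S(m,n,α,β,T)` over the T-mesh: membership only constrains the values
on the occupied region `Ω` (smoothness is required within `Ω`). -/
def SOn (m n : ℕ) (α β : ℤ) (T : TMesh) : Set (ℝ × ℝ → ℝ) :=
  {f | PiecewisePoly m n T f ∧ SmoothWithin T.Omega α β f}

/-- The set of functions `S` is a linear space of dimension `d`. -/
def HasDim (S : Set (ℝ × ℝ → ℝ)) (d : ℕ) : Prop :=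
  ∃ b : Fin d → (ℝ × ℝ → ℝ), (∀ i, b i ∈ S) ∧ LinearIndependent ℝ b ∧
    ∀ f ∈ S, ∃ c : Fin d → ℝ, f = ∑ i, c i • b i

/-- The linear space `S` has dimension at least `d`. -/
def DimGE (S : Set (ℝ × ℝ → ℝ)) (d : ℕ) : Prop :=
  ∃ b : Fin d → (ℝ × ℝ → ℝ), (∀ i, b i ∈ S) ∧ LinearIndependent ℝ b

/-- The set of functions `S`, regarded as a space of functions on `Ω` (i.e. modulo the
values outside `Ω`), has dimension `d`. -/
def HasDimOn (Ω : Set (ℝ × ℝ)) (S : Set (ℝ × ℝ → ℝ)) (d : ℕ) : Prop :=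
  ∃ b : Fin d → (ℝ × ℝ → ℝ), (∀ i, b i ∈ S) ∧
    LinearIndependent ℝ (fun i => Ω.restrict (b i)) ∧
    ∀ f ∈ S, ∃ c : Fin d → ℝ, Set.EqOn f (∑ i, c i • b i) Ω

/-! The integration operator `I` and one-sided limits. -/

/-- `I(g)(x,y) = ∫_{-∞}^x ∫_{-∞}^y g(s,t) dt ds`. -/
def Ig (g : ℝ × ℝ → ℝ) : ℝ × ℝ → ℝ :=
  fun p => ∫ s in Set.Iic p.1, (∫ t in Set.Iic p.2, g (s, t))

/-- `g(s, y−)`, the one-sided limit from below in the second variable. -/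
def limBelowY (g : ℝ × ℝ → ℝ) (y s : ℝ) : ℝ := limUnder (𝓝[<] y) fun t => g (s, t)
/-- `g(s, y+)`. -/
def limAboveY (g : ℝ × ℝ → ℝ) (y s : ℝ) : ℝ := limUnder (𝓝[>] y) fun t => g (s, t)
/-- `g(x−, t)`. -/
def limLeftX (g : ℝ × ℝ → ℝ) (x t : ℝ) : ℝ := limUnder (𝓝[<] x) fun s => g (s, t)
/-- `g(x+, t)`. -/
def limRightX (g : ℝ × ℝ → ℝ) (x t : ℝ) : ℝ := limUnder (𝓝[>] x) fun s => g (s, t)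

/-- The (cell-wise) partial derivative in `x`. -/
def pdX (f : ℝ × ℝ → ℝ) : ℝ × ℝ → ℝ := fun p => deriv (fun x => f (x, p.2)) p.1
/-- The (cell-wise) partial derivative in `y`. -/
def pdY (f : ℝ × ℝ → ℝ) : ℝ × ℝ → ℝ := fun p => deriv (fun y => f (p.1, y)) p.2

/-- The union of the open interiors of the cells. -/
def cellInteriors (T : TMesh) : Set (ℝ × ℝ) := ⋃ c ∈ T.cells, interior c.toSet

open Classical in
/-- The cell-wise mixed partial derivative `∂²f/∂x∂y`, set to `0` off the cell interiors. -/
def Dmix (T : TMesh) (f : ℝ × ℝ → ℝ) : ℝ × ℝ → ℝ :=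
  fun p => if p ∈ cellInteriors T then pdX (pdY f) p else 0

/-! Extended T-meshes. -/

/-- The skeleton of a tensor-product mesh with grid lines `X 0 < ⋯ < X (2m+1)` and
`Y 0 < ⋯ < Y (2n+1)`. -/
def gridSkeleton (m n : ℕ) (X Y : ℕ → ℝ) : Set (ℝ × ℝ) :=
  {p : ℝ × ℝ | (∃ i ≤ 2 * m + 1, p.1 = X i) ∧ Y 0 ≤ p.2 ∧ p.2 ≤ Y (2 * n + 1)} ∪
  {p : ℝ × ℝ | (∃ j ≤ 2 * n + 1, p.2 = Y j) ∧ X 0 ≤ p.1 ∧ p.1 ≤ X (2 * m + 1)}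

/-- The straight extensions, up to the rectangle `[x0,x1] × [y0,y1]`, of every l-edge of `T`
having an endpoint on the boundary of the region of `T`. -/
def extSegs (T : TMesh) (x0 x1 y0 y1 : ℝ) : Set (ℝ × ℝ) :=
  {p : ℝ × ℝ | ∃ a b y, HorizLEdgeAt T a b y ∧ a = T.outer.xmin ∧
      p.2 = y ∧ x0 ≤ p.1 ∧ p.1 ≤ a} ∪
  {p : ℝ × ℝ | ∃ a b y, HorizLEdgeAt T a b y ∧ b = T.outer.xmax ∧
      p.2 = y ∧ b ≤ p.1 ∧ p.1 ≤ x1} ∪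
  {p : ℝ × ℝ | ∃ x a b, a < b ∧ IsLEdge T (({x} : Set ℝ) ×ˢ Set.Icc a b) ∧ a = T.outer.ymin ∧
      p.1 = x ∧ y0 ≤ p.2 ∧ p.2 ≤ a} ∪
  {p : ℝ × ℝ | ∃ x a b, a < b ∧ IsLEdge T (({x} : Set ℝ) ×ˢ Set.Icc a b) ∧ b = T.outer.ymax ∧
      p.1 = x ∧ b ≤ p.2 ∧ p.2 ≤ y1}

/-- `Te` is an extension of `T` associated with `S(m,n,m-1,n-1,T)`: a tensor-product mesh with
`2(m+1)` vertical and `2(n+1)` horizontal grid lines whose central rectangle is the region of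
`T`, together with `T` and the straight extensions of all boundary-reaching edges of `T`. -/
def IsExtensionOf (m n : ℕ) (T Te : TMesh) : Prop :=
  ∃ X Y : ℕ → ℝ,
    (∀ i < 2 * m + 1, X i < X (i + 1)) ∧ (∀ j < 2 * n + 1, Y j < Y (j + 1)) ∧
    X m = T.outer.xmin ∧ X (m + 1) = T.outer.xmax ∧
    Y n = T.outer.ymin ∧ Y (n + 1) = T.outer.ymax ∧
    Te.outer.xmin = X 0 ∧ Te.outer.xmax = X (2 * m + 1) ∧
    Te.outer.ymin = Y 0 ∧ Te.outer.ymax = Y (2 * n + 1) ∧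
    Te.skeleton = T.skeleton ∪ gridSkeleton m n X Y ∪
      extSegs T (X 0) (X (2 * m + 1)) (Y 0) (Y (2 * n + 1))

/-! Hierarchical T-meshes. -/

/-- `T` is a tensor-product mesh. -/
def IsTensorMesh (T : TMesh) : Prop :=
  ∃ (p q : ℕ) (x y : ℕ → ℝ), 0 < p ∧ 0 < q ∧
    (∀ i < p, x i < x (i + 1)) ∧ (∀ j < q, y j < y (j + 1)) ∧
    T.cells = {c : Rect | ∃ i < p, ∃ j < q,
      c.xmin = x i ∧ c.xmax = x (i + 1) ∧ c.ymin = y j ∧ c.ymax = y (j + 1)}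

/-- The four equal subcells obtained by subdividing a cell by the two segments joining the
midpoints of opposite edges. -/
def Rect.quads (c : Rect) : Set Rect :=
  { ⟨c.xmin, (c.xmin + c.xmax) / 2, c.ymin, (c.ymin + c.ymax) / 2,
      by linarith [c.hx], by linarith [c.hy]⟩,
    ⟨(c.xmin + c.xmax) / 2, c.xmax, c.ymin, (c.ymin + c.ymax) / 2,
      by linarith [c.hx], by linarith [c.hy]⟩,
    ⟨c.xmin, (c.xmin + c.xmax) / 2, (c.ymin + c.ymax) / 2, c.ymax,
      by linarith [c.hx], by linarith [c.hy]⟩,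
    ⟨(c.xmin + c.xmax) / 2, c.xmax, (c.ymin + c.ymax) / 2, c.ymax,
      by linarith [c.hx], by linarith [c.hy]⟩ }

/-- `T'` is obtained from `T` by subdividing exactly the cells in `S` into four quadrants. -/
def StepSubdiv (T T' : TMesh) (S : Set Rect) : Prop :=
  S ⊆ T.cells ∧ T'.outer = T.outer ∧
    T'.cells = (T.cells \ S) ∪ ⋃ c ∈ S, Rect.quads c

/-- A hierarchical T-mesh: the recursive construction `𝒯⁰, 𝒯¹, …, 𝒯^M`. -/
structure HierMesh where
  M : ℕ
  level : ℕ → TMesh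
  subdivided : ℕ → Set Rect
  tensor0 : IsTensorMesh (level 0)
  step : ∀ k < M, StepSubdiv (level k) (level (k + 1)) (subdivided k)

/-- The final mesh `𝒯 = 𝒯^M`. -/
def HierMesh.final (H : HierMesh) : TMesh := H.level H.M

/-- Two cells share a (horizontal or vertical) edge segment of positive length. -/
def EdgeAdjacent (c d : Rect) : Prop :=
  c ≠ d ∧ ∃ s : Set (ℝ × ℝ), (IsHorizSeg s ∨ IsVertSeg s) ∧ s ⊆ c.toSet ∩ d.toSet

/-- `c` is an isolated subdivided cell at step `k`: it is subdivided at step `k`, but no cell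
of the level-`k` mesh sharing a horizontal or vertical edge with it is subdivided then. -/
def IsIsolatedAt (H : HierMesh) (k : ℕ) (c : Rect) : Prop :=
  k < H.M ∧ c ∈ H.subdivided k ∧
    ∀ d ∈ (H.level k).cells, EdgeAdjacent c d → d ∉ H.subdivided k

/-- The isolated subdivided cells occurring in the construction of `H`. -/
def isoCells (H : HierMesh) : Set Rect := {c | ∃ k, IsIsolatedAt H k c}

/-- A regular T-mesh is crossing-vertex connected: any two distinct crossing vertices are
joined by a poly-line of axis-parallel mesh edges all of whose (corner) joints are crossing
vertices. -/
def IsCVConnected (T : TMesh) : Prop :=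
  ∀ u v : ℝ × ℝ, IsCrossingVertex T u → IsCrossingVertex T v → u ≠ v →
    ∃ (N : ℕ) (p : ℕ → ℝ × ℝ), p 0 = u ∧ p N = v ∧
      (∀ i < N, p i ≠ p (i + 1) ∧ segment ℝ (p i) (p (i + 1)) ⊆ T.skeleton ∧
        ((p i).1 = (p (i + 1)).1 ∨ (p i).2 = (p (i + 1)).2)) ∧
      (∀ i, 0 < i → i < N →
        (((p (i - 1)).2 = (p i).2 ∧ (p i).1 = (p (i + 1)).1) ∨
         ((p (i - 1)).1 = (p i).1 ∧ (p i).2 = (p (i + 1)).2)) →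
        IsCrossingVertex T (p i))

/-- The level of an l-edge `s`: the first level of the hierarchy whose skeleton contains it. -/
def LEdgeLevel (H : HierMesh) (s : Set (ℝ × ℝ)) (k : ℕ) : Prop :=
  s ⊆ (H.level k).skeleton ∧ ∀ j < k, ¬ s ⊆ (H.level j).skeleton

/-- `yb < yi < yt` are the heights of the two support l-edges of the horizontal l-edge
`[a,b] × {yi}` of the hierarchical mesh `H`: for a level-0 l-edge, the nearest level-0
horizontal l-edges below and above; for a level-`(k+1)` l-edge, the heights of the bottom
and top edges of a cell subdivided at step `k` whose inserted cross has its horizontal arm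
on the l-edge. -/
def SupportHeights (H : HierMesh) (a b yi yb yt : ℝ) : Prop :=
  yb < yi ∧ yi < yt ∧
  ((LEdgeLevel H (Set.Icc a b ×ˢ ({yi} : Set ℝ)) 0 ∧
     (∃ a' b', HorizLEdgeAt (H.level 0) a' b' yb) ∧
     (∃ a' b', HorizLEdgeAt (H.level 0) a' b' yt) ∧
     (∀ y a' b', HorizLEdgeAt (H.level 0) a' b' y → ¬(yb < y ∧ y < yt ∧ y ≠ yi))) ∨
   (∃ k, LEdgeLevel H (Set.Icc a b ×ˢ ({yi} : Set ℝ)) (k + 1) ∧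
     ∃ c ∈ H.subdivided k, c.ymin = yb ∧ c.ymax = yt ∧ (c.ymin + c.ymax) / 2 = yi ∧
       a ≤ c.xmin ∧ c.xmax ≤ b))

/-- `U j` is a proper submesh of `U i` (its region is strictly contained in that of `U i`). -/
def ProperSubmesh {ι : Type*} (U : ι → TMesh) (j i : ι) : Prop :=
  j ≠ i ∧ (U j).Omega ⊆ (U i).Omega ∧ (U j).Omega ≠ (U i).Omega

/-! The CVR graph. -/

/-- An edge of the CVR graph: a segment joining two consecutive crossing vertices along an
l-edge. -/
def IsCVREdge (T : TMesh) (s : Set (ℝ × ℝ)) : Prop :=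
  ∃ u v : ℝ × ℝ, u ≠ v ∧ s = segment ℝ u v ∧ IsCrossingVertex T u ∧ IsCrossingVertex T v ∧
    (∃ l, IsLEdge T l ∧ segment ℝ u v ⊆ l) ∧
    ∀ w ∈ segment ℝ u v, IsCrossingVertex T w → w = u ∨ w = v

/-- The union of the edges of the CVR graph, as a plane set. -/
def cvrGraphSet (T : TMesh) : Set (ℝ × ℝ) := ⋃₀ {s | IsCVREdge T s}

/-- The number of edges of the CVR graph. -/
def cvrEdgeCount (T : TMesh) : ℕ := {s | IsCVREdge T s}.ncard

/-- The number of bounded faces of the CVR graph: bounded connected components of the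
complement of the union of its edges. -/
def cvrFaceCount (T : TMesh) : ℕ :=
  {U : Set (ℝ × ℝ) | (∃ p ∈ (cvrGraphSet T)ᶜ, U = connectedComponentIn (cvrGraphSet T)ᶜ p) ∧
     Bornology.IsBounded U}.ncard

/-! ### Pointwise descriptions of cells and of the skeleton -/

lemma Rect.mem_toSet {c : Rect} {p : ℝ × ℝ} :
    p ∈ c.toSet ↔ (c.xmin ≤ p.1 ∧ p.1 ≤ c.xmax) ∧ (c.ymin ≤ p.2 ∧ p.2 ≤ c.ymax) := Iff.rfl

lemma Rect.mem_interior_toSet {c : Rect} {p : ℝ × ℝ} :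
    p ∈ interior c.toSet ↔ (c.xmin < p.1 ∧ p.1 < c.xmax) ∧ (c.ymin < p.2 ∧ p.2 < c.ymax) := by
  rw [Rect.toSet, interior_prod_eq, interior_Icc, interior_Icc]
  rfl

lemma Rect.toSet_subset_closure_interior (c : Rect) : c.toSet ⊆ closure (interior c.toSet) := by
  rw [Rect.toSet, interior_prod_eq, closure_prod_eq, interior_Icc, interior_Icc,
    closure_Ioo c.hx.ne, closure_Ioo c.hy.ne]

lemma Rect.mem_frontier_toSet {c : Rect} {p : ℝ × ℝ} :
    p ∈ frontier c.toSet ↔ p ∈ c.toSet ∧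
      (p.1 = c.xmin ∨ p.1 = c.xmax ∨ p.2 = c.ymin ∨ p.2 = c.ymax) := by
  have hc : IsClosed c.toSet := isClosed_Icc.prod isClosed_Icc
  rw [hc.frontier_eq, Set.mem_sdiff, Rect.mem_interior_toSet, Rect.mem_toSet]
  grind

lemma TMesh.mem_skeleton {T : TMesh} {p : ℝ × ℝ} :
    p ∈ T.skeleton ↔ ∃ c ∈ T.cells, p ∈ c.toSet ∧
      (p.1 = c.xmin ∨ p.1 = c.xmax ∨ p.2 = c.ymin ∨ p.2 = c.ymax) := by
  simp only [TMesh.skeleton, Set.mem_iUnion, Rect.mem_frontier_toSet, exists_prop]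

lemma TMesh.exists_cell {T : TMesh} {p : ℝ × ℝ} (hp : p ∈ T.Omega) : ∃ c ∈ T.cells, p ∈ c.toSet := by
  have : p ∈ ⋃ c ∈ T.cells, c.toSet := by rw [T.union_eq]; exact hp
  simpa using this

lemma TMesh.cell_subset {T : TMesh} {c : Rect} (hc : c ∈ T.cells) : c.toSet ⊆ T.outer.toSet := by
  rw [← T.union_eq]
  exact Set.subset_biUnion_of_mem hc

lemma TMesh.cell_bounds {T : TMesh} {c : Rect} (hc : c ∈ T.cells) :
    T.outer.xmin ≤ c.xmin ∧ c.xmax ≤ T.outer.xmax ∧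
      T.outer.ymin ≤ c.ymin ∧ c.ymax ≤ T.outer.ymax := by
  have h1 : (c.xmin, c.ymin) ∈ T.outer.toSet :=
    T.cell_subset hc (by simp [Rect.mem_toSet, c.hx.le, c.hy.le])
  have h2 : (c.xmax, c.ymax) ∈ T.outer.toSet :=
    T.cell_subset hc (by simp [Rect.mem_toSet, c.hx.le, c.hy.le])
  rw [Rect.mem_toSet] at h1 h2
  exact ⟨h1.1.1, h2.1.2, h1.2.1, h2.2.2⟩

lemma TMesh.skeleton_subset (T : TMesh) : T.skeleton ⊆ T.outer.toSet := fun p hp => by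
  obtain ⟨c, hc, hpc, -⟩ := TMesh.mem_skeleton.1 hp
  exact T.cell_subset hc hpc

lemma TMesh.interior_cell_disjoint_skeleton {T : TMesh} {c : Rect} (hc : c ∈ T.cells)
    {p : ℝ × ℝ} (hp : p ∈ interior c.toSet) : p ∉ T.skeleton := by
  intro hs
  obtain ⟨d, hd, hpd⟩ : ∃ d ∈ T.cells, p ∈ frontier d.toSet := by
    simpa [TMesh.skeleton] using hs
  by_cases hcd : c = d
  · subst hcd
    exact hpd.2 hp
  · have hcl := d.toSet_subset_closure_interior (Rect.mem_frontier_toSet.1 hpd).1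
    obtain ⟨q, hqc, hqd⟩ := mem_closure_iff.1 hcl _ isOpen_interior hp
    exact Set.disjoint_left.1 (T.pairwise_disjoint hc hd hcd) hqc hqd

/-! ### Exchanging the two coordinates -/

/-- The mirror image of a rectangle in the diagonal. -/
def Rect.swap (c : Rect) : Rect := ⟨c.ymin, c.ymax, c.xmin, c.xmax, c.hy, c.hx⟩

lemma Rect.toSet_swap (c : Rect) : c.swap.toSet = Homeomorph.prodComm ℝ ℝ ⁻¹' c.toSet := by
  ext p
  simp [Rect.mem_toSet, Rect.swap, and_comm]

lemma Rect.swap_swap (c : Rect) : c.swap.swap = c := rfl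

/-- The mirror image of a T-mesh in the diagonal. -/
def TMesh.swap (T : TMesh) : TMesh where
  cells := Rect.swap ⁻¹' T.cells
  outer := T.outer.swap
  finite_cells := T.finite_cells.preimage
    (Function.LeftInverse.injective (g := Rect.swap) Rect.swap_swap).injOn
  pairwise_disjoint := by
    intro c hc d hd hcd
    have hne : c.swap ≠ d.swap := fun h => hcd (congrArg Rect.swap h)
    have := T.pairwise_disjoint hc hd hne
    rw [← c.swap_swap, ← d.swap_swap, c.swap.toSet_swap, d.swap.toSet_swap,
      ← Homeomorph.preimage_interior, ← Homeomorph.preimage_interior]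
    exact this.preimage _
  union_eq := by
    rw [T.outer.toSet_swap, ← T.union_eq]
    ext p
    simp only [Set.mem_iUnion, Set.mem_preimage, exists_prop]
    constructor
    · rintro ⟨c, hc, hp⟩
      refine ⟨c.swap, hc, ?_⟩
      rw [← c.swap_swap, c.swap.toSet_swap] at hp
      exact hp
    · rintro ⟨c, hc, hp⟩
      refine ⟨c.swap, hc, ?_⟩
      rw [c.toSet_swap]
      exact hp

lemma TMesh.mem_skeleton_swap {T : TMesh} {p : ℝ × ℝ} :
    p ∈ T.swap.skeleton ↔ p.swap ∈ T.skeleton := by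
  simp only [TMesh.mem_skeleton, Rect.mem_toSet]
  constructor <;>
  · rintro ⟨c, hc, hp⟩
    refine ⟨c.swap, hc, ?_⟩
    simp only [Rect.swap, Prod.fst_swap, Prod.snd_swap] at *
    tauto

lemma isVertexOf_swap {T : TMesh} {p : ℝ × ℝ} :
    IsVertexOf T.swap p ↔ IsVertexOf T p.swap := by
  constructor <;>
  · rintro ⟨c, hc, hp⟩
    refine ⟨c.swap, hc, ?_⟩
    simp only [Rect.swap, Prod.fst_swap, Prod.snd_swap] at *
    tauto

/-! ### Horizontal edges -/

/-- The horizontal segment `[a,b] × {y}` lies in the skeleton. -/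
def HSkel (T : TMesh) (a b y : ℝ) : Prop := ∀ x ∈ Set.Icc a b, (x, y) ∈ T.skeleton

/-- The triple `(a, b, y)` encodes a horizontal l-edge `[a,b] × {y}`. -/
def IsHEdge (T : TMesh) (e : ℝ × ℝ × ℝ) : Prop :=
  e.1 < e.2.1 ∧ HSkel T e.1 e.2.1 e.2.2 ∧
    ∀ a b, a ≤ e.1 → e.2.1 ≤ b → HSkel T a b e.2.2 → a = e.1 ∧ b = e.2.1

section HEdge

variable {T : TMesh}

lemma HSkel.union {a b a' b' y : ℝ} (h : HSkel T a b y) (h' : HSkel T a' b' y)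
    (h1 : a' ≤ b) (h2 : a ≤ b') : HSkel T (min a a') (max b b') y := by
  intro x hx
  rw [Set.mem_Icc, min_le_iff, le_max_iff] at hx
  by_cases hxab : x ∈ Set.Icc a b
  · exact h x hxab
  · refine h' x ?_
    rw [Set.mem_Icc] at hxab ⊢
    grind

lemma hSkel_of_cell {c : Rect} (hc : c ∈ T.cells) {y : ℝ} (hy : y = c.ymin ∨ y = c.ymax) :
    HSkel T c.xmin c.xmax y := by
  intro x hx
  refine TMesh.mem_skeleton.2 ⟨c, hc, ⟨hx, ?_⟩, by tauto⟩
  have := c.hy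
  rcases hy with rfl | rfl <;> simp [this.le]

lemma IsHEdge.eq_of_overlap {e : ℝ × ℝ × ℝ} (he : IsHEdge T e) {a b : ℝ}
    (h : HSkel T a b e.2.2) (h1 : a ≤ e.2.1) (h2 : e.1 ≤ b) : e.1 ≤ a ∧ b ≤ e.2.1 := by
  have := he.2.2 _ _ (min_le_left _ _) (le_max_left _ _) (he.2.1.union h h1 h2)
  exact ⟨min_eq_left_iff.1 this.1, max_eq_left_iff.1 this.2⟩

lemma IsHEdge.eq_of_mem {e e' : ℝ × ℝ × ℝ} (he : IsHEdge T e) (he' : IsHEdge T e')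
    (hy : e.2.2 = e'.2.2) {x : ℝ} (hx : x ∈ Set.Icc e.1 e.2.1) (hx' : x ∈ Set.Icc e'.1 e'.2.1) :
    e = e' := by
  have h1 := he.eq_of_overlap (hy ▸ he'.2.1) (hx'.1.trans hx.2) (hx.1.trans hx'.2)
  have h2 := he'.eq_of_overlap (hy ▸ he.2.1) (hx.1.trans hx'.2) (hx'.1.trans hx.2)
  exact Prod.ext (le_antisymm h1.1 h2.1) (Prod.ext (le_antisymm h2.2 h1.2) hy)

/-- Just to the left of `a` there are no `x`-coordinates of cells. -/
lemma TMesh.eventually_left (T : TMesh) (a : ℝ) : ∀ᶠ t in 𝓝[<] a, ∀ c ∈ T.cells,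
    (t ≤ c.xmin → a ≤ c.xmin) ∧ (t ≤ c.xmax → a ≤ c.xmax) := by
  have key (z : ℝ) : ∀ᶠ t in 𝓝[<] a, t ≤ z → a ≤ z := by
    by_cases hz : a ≤ z
    · exact Eventually.of_forall fun _ _ => hz
    · filter_upwards [Ioo_mem_nhdsLT (not_le.1 hz)] with t ht h
      exact absurd h (not_le.2 ht.1)
  rw [eventually_all_finite T.finite_cells]
  exact fun c _ => (key _).and (key _)

/-- Just to the right of `a` there are no `x`-coordinates of cells. -/
lemma TMesh.eventually_right (T : TMesh) (a : ℝ) : ∀ᶠ t in 𝓝[>] a, ∀ c ∈ T.cells,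
    (c.xmin ≤ t → c.xmin ≤ a) ∧ (c.xmax ≤ t → c.xmax ≤ a) := by
  have key (z : ℝ) : ∀ᶠ t in 𝓝[>] a, z ≤ t → z ≤ a := by
    by_cases hz : z ≤ a
    · exact Eventually.of_forall fun _ _ => hz
    · filter_upwards [Ioo_mem_nhdsGT (not_le.1 hz)] with t ht h
      exact absurd h (not_le.2 ht.2)
  rw [eventually_all_finite T.finite_cells]
  exact fun c _ => (key _).and (key _)

lemma HSkel.exists_cell_left {a b y : ℝ} (hab : a < b) (h : HSkel T a b y) :
    ∃ c ∈ T.cells, c.xmin < b ∧ b ≤ c.xmax ∧ (y = c.ymin ∨ y = c.ymax) := by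
  obtain ⟨t, ht, hta, htb⟩ := ((T.eventually_left b).and (Ioo_mem_nhdsLT hab)).exists
  obtain ⟨c, hc, hp, h4⟩ := TMesh.mem_skeleton.1 (h t ⟨hta.le, htb.le⟩)
  rw [Rect.mem_toSet] at hp
  have := ht c hc
  refine ⟨c, hc, ?_⟩
  grind

lemma HSkel.exists_cell_right {a b y : ℝ} (hab : a < b) (h : HSkel T a b y) :
    ∃ c ∈ T.cells, c.xmin ≤ a ∧ a < c.xmax ∧ (y = c.ymin ∨ y = c.ymax) := by
  obtain ⟨t, ht, hta, htb⟩ := ((T.eventually_right a).and (Ioo_mem_nhdsGT hab)).exists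
  obtain ⟨c, hc, hp, h4⟩ := TMesh.mem_skeleton.1 (h t ⟨hta.le, htb.le⟩)
  rw [Rect.mem_toSet] at hp
  have := ht c hc
  refine ⟨c, hc, ?_⟩
  grind

lemma IsHEdge.isVertexOf_left {e : ℝ × ℝ × ℝ} (he : IsHEdge T e) :
    IsVertexOf T (e.1, e.2.2) := by
  obtain ⟨c, hc, h1, h2, hy⟩ := he.2.1.exists_cell_right he.1
  have := he.eq_of_overlap (hSkel_of_cell hc hy) (h1.trans he.1.le) h2.le
  exact ⟨c, hc, Or.inl (le_antisymm this.1 h1), hy⟩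

lemma IsHEdge.isVertexOf_right {e : ℝ × ℝ × ℝ} (he : IsHEdge T e) :
    IsVertexOf T (e.2.1, e.2.2) := by
  obtain ⟨c, hc, h1, h2, hy⟩ := he.2.1.exists_cell_left he.1
  have := he.eq_of_overlap (hSkel_of_cell hc hy) h1.le (he.1.le.trans h2)
  exact ⟨c, hc, Or.inr (le_antisymm h2 this.2), hy⟩

lemma finite_isVertexOf (T : TMesh) : {p | IsVertexOf T p}.Finite := by
  refine (T.finite_cells.biUnion (t := fun c : Rect =>
    (({c.xmin, c.xmax} : Set ℝ) ×ˢ ({c.ymin, c.ymax} : Set ℝ))) fun c _ => ?_).subset ?_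
  · exact (Set.toFinite _).prod (Set.toFinite _)
  · rintro p ⟨c, hc, hp⟩
    simp only [Set.mem_iUnion]
    exact ⟨c, hc, by simpa using hp⟩

lemma finite_isHEdge (T : TMesh) : {e | IsHEdge T e}.Finite := by
  refine (((finite_isVertexOf T).prod (finite_isVertexOf T)).image
    fun q => (q.1.1, q.2.1, q.1.2)).subset ?_
  intro e he
  exact ⟨((e.1, e.2.2), (e.2.1, e.2.2)), ⟨he.isVertexOf_left, he.isVertexOf_right⟩, rfl⟩

lemma IsVertexOf.exists_isHEdge {p : ℝ × ℝ} (hp : IsVertexOf T p) :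
    ∃ e, IsHEdge T e ∧ e.2.2 = p.2 ∧ p.1 ∈ Set.Icc e.1 e.2.1 := by
  let S : Set (ℝ × ℝ) := {q | IsVertexOf T (q.1, p.2) ∧ IsVertexOf T (q.2, p.2) ∧
    q.1 < q.2 ∧ p.1 ∈ Set.Icc q.1 q.2 ∧ HSkel T q.1 q.2 p.2}
  have hfin : S.Finite := by
    refine (((finite_isVertexOf T).prod (finite_isVertexOf T)).image
      fun q => (q.1.1, q.2.1)).subset ?_
    intro q hq
    exact ⟨((q.1, p.2), (q.2, p.2)), ⟨hq.1, hq.2.1⟩, rfl⟩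
  have hne : S.Nonempty := by
    obtain ⟨c, hc, hx, hy⟩ := hp
    refine ⟨(c.xmin, c.xmax), ⟨c, hc, Or.inl rfl, hy⟩, ⟨c, hc, Or.inr rfl, hy⟩, c.hx, ?_,
      hSkel_of_cell hc hy⟩
    have := c.hx
    rcases hx with h | h <;> simp [h, this.le]
  obtain ⟨⟨a, b⟩, ⟨ha, hb, hab, hpm, hs⟩, hmax⟩ := hfin.exists_maximalFor (fun q => q.2 - q.1) S hne
  refine ⟨(a, b, p.2), ⟨hab, hs, fun a' b' ha' hb' hs' => ⟨?_, ?_⟩⟩, rfl, hpm⟩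
  · by_contra hne
    obtain ⟨c, hc, h1, h2, hy⟩ := HSkel.exists_cell_left (lt_of_le_of_ne ha' hne)
      (fun x hx => hs' x ⟨hx.1, hx.2.trans (hab.le.trans hb')⟩)
    have hu : HSkel T c.xmin b p.2 := fun x hx => by
      by_cases hxa : x ≤ a
      · exact hSkel_of_cell hc hy x ⟨hx.1, hxa.trans h2⟩
      · exact hs x ⟨(not_le.1 hxa).le, hx.2⟩
    have := hmax (j := (c.xmin, b)) ⟨⟨c, hc, Or.inl rfl, hy⟩, hb, h1.trans hab,
      ⟨h1.le.trans hpm.1, hpm.2⟩, hu⟩ (by simp only; linarith)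
    simp only at this h1
    linarith
  · by_contra hne
    obtain ⟨c, hc, h1, h2, hy⟩ := HSkel.exists_cell_right (lt_of_le_of_ne hb' (Ne.symm hne))
      (fun x hx => hs' x ⟨ha'.trans (hab.le.trans hx.1), hx.2⟩)
    have hu : HSkel T a c.xmax p.2 := fun x hx => by
      by_cases hxb : b ≤ x
      · exact hSkel_of_cell hc hy x ⟨h1.trans hxb, hx.2⟩
      · exact hs x ⟨hx.1, (not_le.1 hxb).le⟩
    have := hmax (j := (a, c.xmax)) ⟨ha, ⟨c, hc, Or.inr rfl, hy⟩, hab.trans h2,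
      ⟨hpm.1, hpm.2.trans h2.le⟩, hu⟩ (by simp only; linarith)
    simp only at this h2
    linarith

lemma IsHEdge.bounds {e : ℝ × ℝ × ℝ} (he : IsHEdge T e) :
    T.outer.xmin ≤ e.1 ∧ e.2.1 ≤ T.outer.xmax ∧
      T.outer.ymin ≤ e.2.2 ∧ e.2.2 ≤ T.outer.ymax := by
  have h1 := Rect.mem_toSet.1 (T.skeleton_subset (he.2.1 e.1 ⟨le_rfl, he.1.le⟩))
  have h2 := Rect.mem_toSet.1 (T.skeleton_subset (he.2.1 e.2.1 ⟨he.1.le, le_rfl⟩))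
  exact ⟨h1.1.1, h2.1.2, h1.2.1, h1.2.2⟩

/-- A horizontal edge at a height strictly inside a cell does not enter that cell. -/
lemma IsHEdge.not_enter_cell {e : ℝ × ℝ × ℝ} (he : IsHEdge T e) {c : Rect} (hc : c ∈ T.cells)
    (h1 : c.ymin < e.2.2) (h2 : e.2.2 < c.ymax) {x : ℝ} (hx : x ∈ Set.Icc c.xmin c.xmax) :
    x ≤ e.1 ∨ e.2.1 ≤ x := by
  by_contra! h
  have hlt : max c.xmin e.1 < min c.xmax e.2.1 := by
    have := c.hx
    have := hx.1
    have := hx.2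
    have := he.1
    simp only [max_lt_iff, lt_min_iff]
    grind
  obtain ⟨t, ht1, ht2⟩ := exists_between hlt
  rw [max_lt_iff] at ht1
  rw [lt_min_iff] at ht2
  refine T.interior_cell_disjoint_skeleton hc (p := (t, e.2.2)) ?_
    (he.2.1 t ⟨ht1.2.le, ht2.2.le⟩)
  exact Rect.mem_interior_toSet.2 ⟨⟨ht1.1, ht2.1⟩, h1, h2⟩

lemma hSkel_bottom (T : TMesh) : HSkel T T.outer.xmin T.outer.xmax T.outer.ymin := by
  intro x hx
  obtain ⟨c, hc, hp⟩ := T.exists_cell (p := (x, T.outer.ymin)) ⟨hx, le_rfl, T.outer.hy.le⟩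
  have hb := T.cell_bounds hc
  refine TMesh.mem_skeleton.2 ⟨c, hc, hp, Or.inr (Or.inr (Or.inl ?_))⟩
  exact le_antisymm hb.2.2.1 hp.2.1

lemma hSkel_top (T : TMesh) : HSkel T T.outer.xmin T.outer.xmax T.outer.ymax := by
  intro x hx
  obtain ⟨c, hc, hp⟩ := T.exists_cell (p := (x, T.outer.ymax)) ⟨hx, T.outer.hy.le, le_rfl⟩
  have hb := T.cell_bounds hc
  refine TMesh.mem_skeleton.2 ⟨c, hc, hp, Or.inr (Or.inr (Or.inr ?_))⟩
  exact le_antisymm hp.2.2 hb.2.2.2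

lemma isVertexOf_corner (T : TMesh) {p : ℝ × ℝ} (hx : p.1 = T.outer.xmin ∨ p.1 = T.outer.xmax)
    (hy : p.2 = T.outer.ymin ∨ p.2 = T.outer.ymax) : IsVertexOf T p := by
  have h1 := T.outer.hx
  have h2 := T.outer.hy
  obtain ⟨c, hc, hp⟩ := T.exists_cell (p := p) (by
    rw [TMesh.Omega, Rect.mem_toSet]; grind)
  have hb := T.cell_bounds hc
  rw [Rect.mem_toSet] at hp
  refine ⟨c, hc, ?_⟩
  grind

/-- A horizontal edge on the boundary is a full side. -/
lemma IsHEdge.eq_side {e : ℝ × ℝ × ℝ} (he : IsHEdge T e)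
    (hy : ¬ (T.outer.ymin < e.2.2 ∧ e.2.2 < T.outer.ymax)) :
    e = (T.outer.xmin, T.outer.xmax, T.outer.ymin) ∨
      e = (T.outer.xmin, T.outer.xmax, T.outer.ymax) := by
  have hb := he.bounds
  have key (hs : HSkel T T.outer.xmin T.outer.xmax e.2.2) :
      e = (T.outer.xmin, T.outer.xmax, e.2.2) := by
    have := he.2.2 _ _ hb.1 hb.2.1 hs
    exact Prod.ext this.1.symm (Prod.ext this.2.symm rfl)
  have : e.2.2 = T.outer.ymin ∨ e.2.2 = T.outer.ymax := by grind
  rcases this with h | h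
  · exact Or.inl (h ▸ key (h ▸ hSkel_bottom T))
  · exact Or.inr (h ▸ key (h ▸ hSkel_top T))

end HEdge

/-! ### Truncated squares -/

/-- The truncated square `t₊²`. -/
def truncSq (t : ℝ) : ℝ := max t 0 ^ 2

lemma truncSq_of_nonneg {t : ℝ} (h : 0 ≤ t) : truncSq t = t ^ 2 := by rw [truncSq, max_eq_left h]

lemma truncSq_of_nonpos {t : ℝ} (h : t ≤ 0) : truncSq t = 0 := by simp [truncSq, max_eq_right h]

lemma hasDerivAt_truncSq (t : ℝ) : HasDerivAt truncSq (2 * max t 0) t := by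
  rcases lt_trichotomy t 0 with h | rfl | h
  · rw [max_eq_right h.le, mul_zero]
    exact (hasDerivAt_const t (0 : ℝ)).congr_of_eventuallyEq
      ((eventually_lt_nhds h).mono fun s hs => truncSq_of_nonpos hs.le)
  · have h1 : HasDerivWithinAt truncSq (2 * max (0 : ℝ) 0) (Set.Iic 0) 0 := by
      simpa using (hasDerivWithinAt_const (0 : ℝ) (Set.Iic 0) (0 : ℝ)).congr
        (fun s hs => truncSq_of_nonpos hs) (truncSq_of_nonpos le_rfl)
    have h2 : HasDerivWithinAt truncSq (2 * max (0 : ℝ) 0) (Set.Ici 0) 0 := by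
      simpa using ((hasDerivAt_pow 2 (0 : ℝ)).hasDerivWithinAt (s := Set.Ici 0)).congr
        (fun s hs => truncSq_of_nonneg hs) (truncSq_of_nonneg le_rfl)
    have := h1.union h2
    rwa [Set.Iic_union_Ici, hasDerivWithinAt_univ] at this
  · rw [max_eq_left h.le]
    have := (hasDerivAt_pow 2 t).congr_of_eventuallyEq (f₁ := truncSq)
      ((eventually_gt_nhds h).mono fun s hs => truncSq_of_nonneg hs.le)
    simpa using this

lemma continuous_truncSq : Continuous truncSq := by
  unfold truncSq
  fun_prop

/-! ### Combinations of products of truncated squares -/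

section Spline

variable {ι : Type*} [Fintype ι]

/-- The function `∑ i, c i (x - x i)₊² (y - y i)₊²`, where `P i = (x i, y i)`. -/
def truncSpline (P : ι → ℝ × ℝ) (c : ι → ℝ) (p : ℝ × ℝ) : ℝ :=
  ∑ i, c i * (truncSq (p.1 - (P i).1) * truncSq (p.2 - (P i).2))

lemma truncSpline_swap (P : ι → ℝ × ℝ) (c : ι → ℝ) (p : ℝ × ℝ) :
    truncSpline (fun i => (P i).swap) c p.swap = truncSpline P c p :=
  Finset.sum_congr rfl fun i _ => by simp [mul_comm]

/-- `truncSpline` as a linear map in the coefficients. -/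
def truncSplineLinear (P : ι → ℝ × ℝ) : (ι → ℝ) →ₗ[ℝ] (ℝ × ℝ → ℝ) where
  toFun := truncSpline P
  map_add' c d := by
    ext p
    simp [truncSpline, add_mul, Finset.sum_add_distrib]
  map_smul' r c := by
    ext p
    simp [truncSpline, mul_assoc, Finset.mul_sum]

lemma truncSplineLinear_injective {P : ι → ℝ × ℝ} (hP : Function.Injective P) :
    Function.Injective (truncSplineLinear P) := by
  rw [injective_iff_map_eq_zero]
  intro c hc
  by_contra hne
  have hS : {i | c i ≠ 0}.Nonempty := Function.ne_iff.1 hne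
  obtain ⟨i, hi, hmin⟩ := (Set.toFinite {i | c i ≠ 0}).exists_minimalFor P _ hS
  have hev : ∀ᶠ δ in 𝓝[>] (0 : ℝ), ∀ j, ((P j).1 < (P i).1 + δ → (P j).1 ≤ (P i).1) ∧
      ((P j).2 < (P i).2 + δ → (P j).2 ≤ (P i).2) := by
    have key (a b : ℝ) : ∀ᶠ δ in 𝓝[>] (0 : ℝ), a < b + δ → a ≤ b := by
      by_cases h : a ≤ b
      · exact Eventually.of_forall fun _ _ => h
      · filter_upwards [Ioo_mem_nhdsGT (sub_pos.2 (not_le.1 h))] with δ hδ hlt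
        linarith [hδ.2]
    rw [eventually_all]
    exact fun j => (key _ _).and (key _ _)
  obtain ⟨δ, hδ, hpos⟩ := (hev.and self_mem_nhdsWithin).exists
  have hpos' : 0 < δ := hpos
  have hval : truncSpline P c ((P i).1 + δ, (P i).2 + δ) = 0 := congrFun hc _
  rw [truncSpline, Finset.sum_eq_single i] at hval
  · rw [add_sub_cancel_left, add_sub_cancel_left, truncSq_of_nonneg hpos'.le] at hval
    have : δ ^ 2 * δ ^ 2 ≠ 0 := by positivity
    exact hi ((mul_eq_zero.1 hval).resolve_right this)
  · intro j _ hji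
    by_contra hj
    have hcj : c j ≠ 0 := left_ne_zero_of_mul hj
    have h1 : (P j).1 < (P i).1 + δ := by
      by_contra! h
      exact hj (by rw [truncSq_of_nonpos (sub_nonpos.2 h)]; ring)
    have h2 : (P j).2 < (P i).2 + δ := by
      by_contra! h
      exact hj (by rw [truncSq_of_nonpos (t := (P i).2 + δ - (P j).2) (sub_nonpos.2 h)]; ring)
    have hle : P j ≤ P i := ⟨(hδ j).1 h1, (hδ j).2 h2⟩
    exact hji (hP (le_antisymm hle (hmin hcj hle)))
  · simp

/-- The first two derivatives of `truncSq`. -/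
def truncSqDeriv : ℕ → ℝ → ℝ
  | 0 => truncSq
  | _ => fun t => 2 * max t 0

lemma continuous_truncSqDeriv (k : ℕ) : Continuous (truncSqDeriv k) := by
  cases k with
  | zero => exact continuous_truncSq
  | succ k =>
    unfold truncSqDeriv
    fun_prop

/-- The partial derivatives of order at most one in each variable of `truncSpline`. -/
def truncSplineDeriv (P : ι → ℝ × ℝ) (c : ι → ℝ) (k l : ℕ) (p : ℝ × ℝ) : ℝ :=
  ∑ i, c i * (truncSqDeriv k (p.1 - (P i).1) * truncSqDeriv l (p.2 - (P i).2))

lemma continuous_truncSplineDeriv (P : ι → ℝ × ℝ) (c : ι → ℝ) (k l : ℕ) :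
    Continuous (truncSplineDeriv P c k l) := by
  have := continuous_truncSqDeriv k
  have := continuous_truncSqDeriv l
  unfold truncSplineDeriv
  fun_prop

lemma hasDerivAt_truncSplineDeriv_fst (P : ι → ℝ × ℝ) (c : ι → ℝ) (l : ℕ) (p : ℝ × ℝ) :
    HasDerivAt (fun x => truncSplineDeriv P c 0 l (x, p.2)) (truncSplineDeriv P c 1 l p) p.1 :=
  HasDerivAt.fun_sum fun i _ =>
    (((hasDerivAt_truncSq _).comp_sub_const p.1 (P i).1).mul_const
      (truncSqDeriv l (p.2 - (P i).2))).const_mul (c i)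

lemma hasDerivAt_truncSplineDeriv_snd (P : ι → ℝ × ℝ) (c : ι → ℝ) (k : ℕ) (p : ℝ × ℝ) :
    HasDerivAt (fun y => truncSplineDeriv P c k 0 (p.1, y)) (truncSplineDeriv P c k 1 p) p.2 :=
  HasDerivAt.fun_sum fun i _ =>
    (((hasDerivAt_truncSq _).comp_sub_const p.2 (P i).2).const_mul
      (truncSqDeriv k (p.1 - (P i).1))).const_mul (c i)

lemma pdXW_truncSplineDeriv (P : ι → ℝ × ℝ) (c : ι → ℝ) (l : ℕ) :
    pdXW Set.univ (truncSplineDeriv P c 0 l) = truncSplineDeriv P c 1 l := by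
  ext p
  simpa [pdXW] using (hasDerivAt_truncSplineDeriv_fst P c l p).deriv

lemma pdYW_truncSplineDeriv (P : ι → ℝ × ℝ) (c : ι → ℝ) (k : ℕ) :
    pdYW Set.univ (truncSplineDeriv P c k 0) = truncSplineDeriv P c k 1 := by
  ext p
  simpa [pdYW] using (hasDerivAt_truncSplineDeriv_snd P c k p).deriv

lemma smoothWithin_truncSpline (P : ι → ℝ × ℝ) (c : ι → ℝ) :
    SmoothWithin Set.univ 1 1 (truncSpline P c) := by
  have h0 : truncSpline P c = truncSplineDeriv P c 0 0 := rfl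
  have hX (i : ℕ) (hi : (i : ℤ) ≤ 1) :
      (pdXW Set.univ)^[i] (truncSpline P c) = truncSplineDeriv P c i 0 := by
    obtain rfl | rfl : i = 0 ∨ i = 1 := by omega
    · rfl
    · exact pdXW_truncSplineDeriv P c 0
  have hXY (i j : ℕ) (hi : (i : ℤ) ≤ 1) (hj : (j : ℤ) ≤ 1) :
      mpW Set.univ i j (truncSpline P c) = truncSplineDeriv P c i j := by
    rw [mpW, hX i hi]
    obtain rfl | rfl : j = 0 ∨ j = 1 := by omega
    · rfl
    · exact pdYW_truncSplineDeriv P c i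
  refine ⟨fun i j hi hj => ?_, fun i hi p _ => ?_, fun i j hi hj p _ => ?_⟩
  · rw [hXY i j hi hj]
    exact (continuous_truncSplineDeriv P c i j).continuousOn
  · obtain rfl : i = 0 := by omega
    rw [hX 0 (by simp), hX 1 (by simp)]
    exact (hasDerivAt_truncSplineDeriv_fst P c 0 p).hasDerivWithinAt
  · obtain rfl : j = 0 := by omega
    rw [hXY i 0 hi (by simp), hXY i 1 hi (by simp)]
    exact (hasDerivAt_truncSplineDeriv_snd P c i p).hasDerivWithinAt

end Spline

/-! ### Separately quadratic functions -/

/-- Evaluating a quadratic polynomial at three distinct nodes determines its coefficients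
linearly. -/
lemma exists_coeff_of_nodes {η : Fin 3 → ℝ} (hη : Function.Injective η) :
    ∃ M : Matrix (Fin 3) (Fin 3) ℝ, ∀ a : Fin 3 → ℝ, ∀ j,
      a j = ∑ m, M j m * ∑ i, a i * η m ^ (i : ℕ) := by
  have hdet : IsUnit (Matrix.vandermonde η).det :=
    isUnit_iff_ne_zero.2 (Matrix.det_vandermonde_ne_zero_iff.2 hη)
  refine ⟨(Matrix.vandermonde η)⁻¹, fun a j => ?_⟩
  have h := congrFun (congrArg (fun N => N.mulVec a) (Matrix.nonsing_inv_mul _ hdet)) j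
  simp only [← Matrix.mulVec_mulVec, Matrix.one_mulVec] at h
  rw [← h]
  simp [Matrix.mulVec, dotProduct, Matrix.vandermonde_apply, mul_comm]

/-- A function on a rectangle that is quadratic in each variable separately is biquadratic. -/
lemma exists_mvPolynomial_of_separately (f : ℝ × ℝ → ℝ) (R : Rect)
    (h1 : ∀ x ∈ Set.Icc R.xmin R.xmax, ∃ a : Fin 3 → ℝ, ∀ y ∈ Set.Icc R.ymin R.ymax,
      f (x, y) = ∑ j, a j * y ^ (j : ℕ))
    (h2 : ∀ y ∈ Set.Icc R.ymin R.ymax, ∃ a : Fin 3 → ℝ, ∀ x ∈ Set.Icc R.xmin R.xmax,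
      f (x, y) = ∑ j, a j * x ^ (j : ℕ)) :
    ∃ p : MvPolynomial (Fin 2) ℝ, p.degreeOf 0 ≤ 2 ∧ p.degreeOf 1 ≤ 2 ∧
      ∀ q ∈ R.toSet, f q = MvPolynomial.eval ![q.1, q.2] p := by
  have hR := R.hy
  let η : Fin 3 → ℝ := ![R.ymin, (R.ymin + R.ymax) / 2, R.ymax]
  have hη : Function.Injective η := by
    refine StrictMono.injective (Fin.strictMono_iff_lt_succ.2 fun i => ?_)
    fin_cases i <;> simp [η] <;> linarith
  have hηm (m : Fin 3) : η m ∈ Set.Icc R.ymin R.ymax := by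
    fin_cases m <;> simp [η] <;> (try constructor) <;> linarith
  obtain ⟨M, hM⟩ := exists_coeff_of_nodes hη
  choose! B hB using fun m => h2 (η m) (hηm m)
  refine ⟨∑ i : Fin 3, ∑ j : Fin 3, MvPolynomial.C (∑ m, M j m * B m i) *
    (MvPolynomial.X 0 ^ (i : ℕ) * MvPolynomial.X 1 ^ (j : ℕ)), ?_, ?_, ?_⟩
  · refine (MvPolynomial.degreeOf_sum_le _ _ _).trans (Finset.sup_le fun i _ => ?_)
    refine (MvPolynomial.degreeOf_sum_le _ _ _).trans (Finset.sup_le fun j _ => ?_)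
    refine (MvPolynomial.degreeOf_C_mul_le _ _ _).trans ((MvPolynomial.degreeOf_mul_le _ _ _).trans ?_)
    have e1 := MvPolynomial.degreeOf_pow_le (0 : Fin 2) (MvPolynomial.X 0 : MvPolynomial (Fin 2) ℝ) i
    have e2 := MvPolynomial.degreeOf_pow_le (0 : Fin 2) (MvPolynomial.X 1 : MvPolynomial (Fin 2) ℝ) j
    have := i.isLt
    have := j.isLt
    simp only [MvPolynomial.degreeOf_X, if_true, Fin.isValue, zero_ne_one, if_false, mul_one,
      mul_zero] at e1 e2
    omega
  · refine (MvPolynomial.degreeOf_sum_le _ _ _).trans (Finset.sup_le fun i _ => ?_)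
    refine (MvPolynomial.degreeOf_sum_le _ _ _).trans (Finset.sup_le fun j _ => ?_)
    refine (MvPolynomial.degreeOf_C_mul_le _ _ _).trans ((MvPolynomial.degreeOf_mul_le _ _ _).trans ?_)
    have e1 := MvPolynomial.degreeOf_pow_le (1 : Fin 2) (MvPolynomial.X 0 : MvPolynomial (Fin 2) ℝ) i
    have e2 := MvPolynomial.degreeOf_pow_le (1 : Fin 2) (MvPolynomial.X 1 : MvPolynomial (Fin 2) ℝ) j
    have := i.isLt
    have := j.isLt
    simp only [MvPolynomial.degreeOf_X, if_true, Fin.isValue, one_ne_zero, if_false, mul_one,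
      mul_zero] at e1 e2
    omega
  · rintro ⟨x, y⟩ ⟨hx, hy⟩
    obtain ⟨a, ha⟩ := h1 x hx
    have haj (j : Fin 3) : a j = ∑ m, M j m * ∑ i, B m i * x ^ (i : ℕ) := by
      rw [hM a j]
      exact Finset.sum_congr rfl fun m _ => by rw [← ha _ (hηm m), hB m x hx]
    rw [ha y hy]
    simp [haj, Fin.sum_univ_three]
    ring

/-! ### Conformality conditions -/

section Conforming

variable {ι : Type*} [Fintype ι] {T : TMesh} {P : ι → ℝ × ℝ} {c : ι → ℝ}

open Classical in
/-- Every point `P i` is assigned to a horizontal l-edge containing it, and along each l-edge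
the coefficients have vanishing moments of order at most two. -/
def HConforming (T : TMesh) (P : ι → ℝ × ℝ) (c : ι → ℝ) : Prop :=
  ∃ e : ι → ℝ × ℝ × ℝ,
    (∀ i, IsHEdge T (e i) ∧ (e i).2.2 = (P i).2 ∧ (P i).1 ∈ Set.Icc (e i).1 (e i).2.1) ∧
    ∀ ε, ∀ k : Fin 3, ∑ i with e i = ε, c i * (P i).1 ^ (k : ℕ) = 0

/-- A conforming spline is a combination of functions `(y - y₀)₊²`, one for each horizontal
l-edge, whose coefficients vanish off the edge. -/
lemma HConforming.exists_sum_edges (h : HConforming T P c) :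
    ∃ (s : Finset (ℝ × ℝ × ℝ)) (G : ℝ × ℝ × ℝ → ℝ → ℝ), (∀ ε ∈ s, IsHEdge T ε) ∧
      (∀ ε ∈ s, ∀ x, x ≤ ε.1 ∨ ε.2.1 ≤ x → G ε x = 0) ∧
      ∀ x y, truncSpline P c (x, y) = ∑ ε ∈ s, G ε x * truncSq (y - ε.2.2) := by
  classical
  obtain ⟨e, he, hmom⟩ := h
  refine ⟨Finset.univ.image e, fun ε x => ∑ i with e i = ε, c i * truncSq (x - (P i).1), ?_, ?_, ?_⟩
  · intro ε hε
    obtain ⟨i, -, rfl⟩ := Finset.mem_image.1 hε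
    exact (he i).1
  · rintro ε - x (hx | hx)
    · refine Finset.sum_eq_zero fun i hi => ?_
      obtain rfl := (Finset.mem_filter.1 hi).2
      rw [truncSq_of_nonpos (by linarith [(he i).2.2.1]), mul_zero]
    · have h0 := hmom ε 0
      have h1 := hmom ε 1
      have h2 := hmom ε 2
      calc ∑ i with e i = ε, c i * truncSq (x - (P i).1)
          = ∑ i with e i = ε, (x ^ 2 * (c i * (P i).1 ^ ((0 : Fin 3) : ℕ))
              - 2 * x * (c i * (P i).1 ^ ((1 : Fin 3) : ℕ))
              + c i * (P i).1 ^ ((2 : Fin 3) : ℕ)) := by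
            refine Finset.sum_congr rfl fun i hi => ?_
            obtain rfl := (Finset.mem_filter.1 hi).2
            rw [truncSq_of_nonneg (by linarith [(he i).2.2.2])]
            simp
            ring
        _ = 0 := by
            rw [Finset.sum_add_distrib, Finset.sum_sub_distrib, ← Finset.mul_sum, ← Finset.mul_sum,
              h0, h1, h2]
            ring
  · intro x y
    rw [truncSpline, ← Finset.sum_fiberwise_of_maps_to (g := e) (t := Finset.univ.image e)
      (fun i _ => Finset.mem_image_of_mem e (Finset.mem_univ i))]
    refine Finset.sum_congr rfl fun ε _ => ?_
    rw [Finset.sum_mul]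
    refine Finset.sum_congr rfl fun i hi => ?_
    obtain rfl := (Finset.mem_filter.1 hi).2
    rw [(he i).2.1, mul_assoc]

lemma HConforming.eq_zero (h : HConforming T P c) {p : ℝ × ℝ}
    (hp : p.1 ≤ T.outer.xmin ∨ T.outer.xmax ≤ p.1) : truncSpline P c p = 0 := by
  obtain ⟨s, G, hs, hG, hsum⟩ := h.exists_sum_edges
  rw [← Prod.mk.eta (p := p), hsum]
  refine Finset.sum_eq_zero fun ε hε => ?_
  have hb := (hs ε hε).bounds
  rw [hG ε hε p.1 (hp.imp (fun h => h.trans hb.1) hb.2.1.trans), zero_mul]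

lemma HConforming.quadratic_on_cell (h : HConforming T P c) {C : Rect} (hC : C ∈ T.cells) {x : ℝ}
    (hx : x ∈ Set.Icc C.xmin C.xmax) : ∃ a : Fin 3 → ℝ, ∀ y ∈ Set.Icc C.ymin C.ymax,
      truncSpline P c (x, y) = ∑ j, a j * y ^ (j : ℕ) := by
  obtain ⟨s, G, hs, hG, hsum⟩ := h.exists_sum_edges
  refine ⟨fun j => ∑ ε ∈ s, if ε.2.2 ≤ C.ymin then G ε x * ![ε.2.2 ^ 2, -2 * ε.2.2, 1] j else 0,
    fun y hy => ?_⟩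
  simp only [hsum, Finset.sum_mul]
  rw [Finset.sum_comm]
  refine Finset.sum_congr rfl fun ε hε => ?_
  split_ifs with hle
  · rw [truncSq_of_nonneg (by linarith [hy.1])]
    simp [Fin.sum_univ_three]
    ring
  · rw [Finset.sum_congr rfl (fun j _ => zero_mul _), Finset.sum_const_zero]
    rcases le_or_gt C.ymax ε.2.2 with h1 | h1
    · rw [truncSq_of_nonpos (by linarith [hy.2]), mul_zero]
    · rw [hG ε hε x ((hs ε hε).not_enter_cell hC (not_le.1 hle) h1 hx), zero_mul]

lemma truncSpline_mem_SBar (h : HConforming T P c)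
    (h' : HConforming T.swap (fun i => (P i).swap) c) : truncSpline P c ∈ SBar 2 2 1 1 T := by
  refine ⟨fun p hp => ?_, fun C hC => ?_, smoothWithin_truncSpline P c⟩
  · rw [TMesh.Omega, Rect.mem_toSet] at hp
    by_cases hx : p.1 ≤ T.outer.xmin ∨ T.outer.xmax ≤ p.1
    · exact h.eq_zero hx
    · rw [← truncSpline_swap]
      refine h'.eq_zero ?_
      change p.2 ≤ T.outer.ymin ∨ T.outer.ymax ≤ p.2
      grind
  · refine exists_mvPolynomial_of_separately _ C (fun x hx => h.quadratic_on_cell hC hx)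
      fun y hy => ?_
    obtain ⟨a, ha⟩ := h'.quadratic_on_cell (C := C.swap) hC hy
    exact ⟨a, fun x hx => by rw [← ha x hx, ← truncSpline_swap]; rfl⟩

end Conforming

/-! ### The rank of the conformality conditions -/

section Rank

variable {ι H W : Type*} [Fintype ι] [Fintype H] [Fintype W]

open Classical in
/-- The moments of order at most two of `c` along the fibres of `e`. -/
def momentMap (e : ι → H) (X : ι → ℝ) : (ι → ℝ) →ₗ[ℝ] (H × Fin 3 → ℝ) where
  toFun c q := ∑ i with e i = q.1, c i * X i ^ (q.2 : ℕ)
  map_add' c d := by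
    ext q
    simp [add_mul, Finset.sum_add_distrib]
  map_smul' r c := by
    ext q
    simp [mul_assoc, Finset.mul_sum]

lemma sum_pow_mul_momentMap (e : ι → H) (X Y : ι → ℝ) (y : H → ℝ) (hy : ∀ i, y (e i) = Y i)
    (c : ι → ℝ) (j : ℕ) (k : Fin 3) :
    ∑ l, y l ^ j * momentMap e X c (l, k) = ∑ i, Y i ^ j * (c i * X i ^ (k : ℕ)) := by
  classical
  rw [← Finset.sum_fiberwise Finset.univ e]
  refine Finset.sum_congr rfl fun l _ => ?_
  simp only [momentMap, LinearMap.coe_mk, AddHom.coe_mk, Finset.mul_sum]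
  refine Finset.sum_congr (by congr) fun i hi => ?_
  obtain rfl := (Finset.mem_filter.1 hi).2
  rw [hy]

/-- The map recording the nine linear relations between horizontal and vertical moments. -/
def relationMap (y : H → ℝ) (x : W → ℝ) :
    ((H × Fin 3 → ℝ) × (W × Fin 3 → ℝ)) →ₗ[ℝ] (Fin 3 × Fin 3 → ℝ) where
  toFun m q := ∑ l, y l ^ (q.2 : ℕ) * m.1 (l, q.1) - ∑ l, x l ^ (q.1 : ℕ) * m.2 (l, q.2)
  map_add' m n := by
    ext q
    simp only [Prod.fst_add, Prod.snd_add, Pi.add_apply, mul_add, Finset.sum_add_distrib]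
    ring
  map_smul' r m := by
    ext q
    simp only [Prod.smul_fst, Prod.smul_snd, Pi.smul_apply, smul_eq_mul, RingHom.id_apply,
      mul_sub, Finset.mul_sum, mul_left_comm]

lemma relationMap_surjective (y : H → ℝ) (x : W → ℝ) (l : Fin 3 → H)
    (hl : Function.Injective fun m => y (l m)) : Function.Surjective (relationMap y x) := by
  classical
  intro t
  have hdet : IsUnit (Matrix.vandermonde fun m => y (l m)).transpose.det := by
    rw [Matrix.det_transpose]
    exact isUnit_iff_ne_zero.2 (Matrix.det_vandermonde_ne_zero_iff.2 hl)
  have hsurj := Matrix.mulVec_surjective_iff_isUnit.2 ((Matrix.isUnit_iff_isUnit_det _).2 hdet)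
  choose u hu using fun i : Fin 3 => hsurj fun j => t (i, j)
  refine ⟨(fun q => ∑ m, if l m = q.1 then u q.2 m else 0, 0), ?_⟩
  ext ⟨i, j⟩
  have := congrFun (hu i) j
  simp only [Matrix.mulVec, dotProduct, Matrix.transpose_apply, Matrix.vandermonde_apply] at this
  simp only [relationMap, LinearMap.coe_mk, AddHom.coe_mk, Pi.zero_apply, mul_zero,
    Finset.sum_const_zero, sub_zero, Finset.mul_sum, mul_ite]
  rw [Finset.sum_comm, ← this]
  simp

lemma card_add_nine_le_finrank_ker (X Y : ι → ℝ) (e : ι → H) (w : ι → W) (y : H → ℝ) (x : W → ℝ)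
    (hy : ∀ i, y (e i) = Y i) (hx : ∀ i, x (w i) = X i) (l : Fin 3 → H)
    (hl : Function.Injective fun m => y (l m)) :
    Fintype.card ι + 9 ≤ Module.finrank ℝ
      (LinearMap.ker ((momentMap e X).prod (momentMap w Y))) +
      3 * (Fintype.card H + Fintype.card W) := by
  set L := (momentMap e X).prod (momentMap w Y)
  have hle : LinearMap.range L ≤ LinearMap.ker (relationMap y x) := by
    rintro _ ⟨c, rfl⟩
    rw [LinearMap.mem_ker]
    ext ⟨i, j⟩
    change ∑ l, y l ^ (j : ℕ) * momentMap e X c (l, i) -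
      ∑ l, x l ^ (i : ℕ) * momentMap w Y c (l, j) = 0
    rw [sum_pow_mul_momentMap e X Y y hy, sum_pow_mul_momentMap w Y X x hx, sub_eq_zero]
    exact Finset.sum_congr rfl fun _ _ => by ring
  have h1 := Submodule.finrank_mono hle
  have h2 := L.finrank_range_add_finrank_ker
  have h3 := (relationMap y x).finrank_range_add_finrank_ker
  rw [LinearMap.range_eq_top.2 (relationMap_surjective y x l hl), finrank_top] at h3
  simp only [Module.finrank_fintype_fun_eq_card, Module.finrank_prod, Fintype.card_prod,
    Fintype.card_fin] at h2 h3
  omega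

end Rank

/-! ### Counting l-edges -/

section Count

variable {T : TMesh}

lemma hSkel_iff_subset {a b y : ℝ} :
    HSkel T a b y ↔ Set.Icc a b ×ˢ ({y} : Set ℝ) ⊆ T.skeleton := by
  constructor
  · rintro h ⟨x, z⟩ ⟨hx, hz⟩
    obtain rfl : z = y := hz
    exact h x hx
  · exact fun h x hx => h ⟨hx, rfl⟩

lemma Icc_prod_singleton_subset {a b y : ℝ} (hab : a < b) {a' b' y' : ℝ} :
    Set.Icc a b ×ˢ ({y} : Set ℝ) ⊆ Set.Icc a' b' ×ˢ ({y'} : Set ℝ) ↔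
      a' ≤ a ∧ b ≤ b' ∧ y = y' := by
  rw [Set.prod_subset_prod_iff, Set.Icc_subset_Icc_iff hab.le, Set.singleton_subset_singleton]
  simp [(Set.nonempty_Icc.2 hab.le).ne_empty, and_assoc]

lemma isHEdge_iff_isLEdge {e : ℝ × ℝ × ℝ} :
    IsHEdge T e ↔ e.1 < e.2.1 ∧ IsLEdge T (Set.Icc e.1 e.2.1 ×ˢ ({e.2.2} : Set ℝ)) := by
  constructor
  · intro he
    refine ⟨he.1, Or.inl ⟨_, _, _, he.1, rfl⟩, hSkel_iff_subset.1 he.2.1, ?_⟩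
    rintro s' (⟨a, b, y, hab, rfl⟩ | ⟨x, a, b, hab, rfl⟩) hs hsub
    · rw [Icc_prod_singleton_subset he.1] at hsub
      obtain ⟨h1, h2, rfl⟩ := hsub
      obtain ⟨rfl, rfl⟩ := he.2.2 a b h1 h2 (hSkel_iff_subset.2 hs)
      rfl
    · have h1 : e.1 = x := (hsub (show (e.1, e.2.2) ∈ _ from ⟨⟨le_rfl, he.1.le⟩, rfl⟩)).1
      have h2 : e.2.1 = x := (hsub (show (e.2.1, e.2.2) ∈ _ from ⟨⟨he.1.le, le_rfl⟩, rfl⟩)).1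
      exact absurd (h1.trans h2.symm) he.1.ne
  · rintro ⟨hlt, -, hs, hmax⟩
    refine ⟨hlt, hSkel_iff_subset.2 hs, fun a b ha hb h => ?_⟩
    have hab : a < b := by linarith
    have := hmax _ (Or.inl ⟨a, b, e.2.2, hab, rfl⟩) (hSkel_iff_subset.1 h)
      ((Icc_prod_singleton_subset hlt).2 ⟨ha, hb, rfl⟩)
    have h1 := (Icc_prod_singleton_subset hab).1 this.subset
    exact ⟨le_antisymm ha h1.1, le_antisymm h1.2.1 hb⟩

lemma isHorizSeg_preimage_swap {s : Set (ℝ × ℝ)} :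
    IsHorizSeg (Prod.swap ⁻¹' s) ↔ IsVertSeg s := by
  constructor
  · rintro ⟨a, b, y, hab, h⟩
    refine ⟨y, a, b, hab, ?_⟩
    rw [← Set.preimage_swap_prod, ← h]
    rfl
  · rintro ⟨x, a, b, hab, rfl⟩
    exact ⟨a, b, x, hab, Set.preimage_swap_prod _ _⟩

lemma isVertSeg_preimage_swap {s : Set (ℝ × ℝ)} :
    IsVertSeg (Prod.swap ⁻¹' s) ↔ IsHorizSeg s := isHorizSeg_preimage_swap.symm

lemma IsLEdge.swap {s : Set (ℝ × ℝ)} (h : IsLEdge T s) : IsLEdge T.swap (Prod.swap ⁻¹' s) := by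
  refine ⟨by rw [isHorizSeg_preimage_swap, isVertSeg_preimage_swap]; exact h.1.symm,
    fun p hp => TMesh.mem_skeleton_swap.2 (h.2.1 hp), fun s' hs' hsub hss' => ?_⟩
  rw [← h.2.2 (Prod.swap ⁻¹' s')]
  · rfl
  · rw [isHorizSeg_preimage_swap, isVertSeg_preimage_swap]
    exact hs'.symm
  · exact fun p hp => TMesh.mem_skeleton_swap.1 (hsub hp)
  · exact fun p hp => hss' hp

/-- The point set of the horizontal l-edge encoded by a triple. -/
def hSet (e : ℝ × ℝ × ℝ) : Set (ℝ × ℝ) := Set.Icc e.1 e.2.1 ×ˢ ({e.2.2} : Set ℝ)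

lemma IsHEdge.eq_of_hSet_eq {e e' : ℝ × ℝ × ℝ} (he : IsHEdge T e) (he' : IsHEdge T e')
    (h : hSet e = hSet e') : e = e' := by
  have h1 := (Icc_prod_singleton_subset he.1).1 h.subset
  have h2 := (Icc_prod_singleton_subset he'.1).1 h.symm.subset
  exact Prod.ext (le_antisymm h2.1 h1.1) (Prod.ext (le_antisymm h1.2.1 h2.2.1) h1.2.2)

/-- The horizontal l-edges that are not on the boundary. -/
def interiorHEdges (T : TMesh) : Set (ℝ × ℝ × ℝ) :=
  {e | IsHEdge T e ∧ T.outer.ymin < e.2.2 ∧ e.2.2 < T.outer.ymax}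

lemma finite_interiorHEdges (T : TMesh) : (interiorHEdges T).Finite :=
  (finite_isHEdge T).subset fun _ h => h.1

lemma ncard_isHEdge_le (T : TMesh) : {e | IsHEdge T e}.ncard ≤ (interiorHEdges T).ncard + 2 := by
  refine (Set.ncard_le_ncard (t := interiorHEdges T ∪
    {(T.outer.xmin, T.outer.xmax, T.outer.ymin), (T.outer.xmin, T.outer.xmax, T.outer.ymax)})
    (fun e he => ?_) ((finite_interiorHEdges T).union (Set.toFinite _))).trans
    ((Set.ncard_union_le _ _).trans (Nat.add_le_add_left 
      ((Set.ncard_insert_le _ _).trans (by rw [Set.ncard_singleton])) _))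
  by_cases hy : T.outer.ymin < e.2.2 ∧ e.2.2 < T.outer.ymax
  · exact Or.inl ⟨he, hy⟩
  · exact Or.inr (he.eq_side hy)

lemma IsHEdge.exists_mem_interior {e : ℝ × ℝ × ℝ} (he : e ∈ interiorHEdges T) :
    ∃ p ∈ hSet e, p ∈ interior T.outer.toSet := by
  obtain ⟨h, h1, h2⟩ := he
  have hb := h.bounds
  have hlt := h.1
  exact ⟨((e.1 + e.2.1) / 2, e.2.2), ⟨⟨by simp only; linarith, by simp only; linarith⟩, rfl⟩,
    Rect.mem_interior_toSet.2 ⟨⟨by simp only; linarith, by simp only; linarith⟩, h1, h2⟩⟩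

lemma isInteriorLEdge_hSet {e : ℝ × ℝ × ℝ} (he : e ∈ interiorHEdges T) :
    IsInteriorLEdge T (hSet e) := by
  obtain ⟨p, hp, hpi⟩ := IsHEdge.exists_mem_interior he
  exact ⟨(isHEdge_iff_isLEdge.1 he.1).2, fun h => (h hp).2 hpi⟩

lemma isInteriorLEdge_preimage_hSet {e : ℝ × ℝ × ℝ} (he : e ∈ interiorHEdges T.swap) :
    IsInteriorLEdge T (Prod.swap ⁻¹' hSet e) := by
  obtain ⟨p, hp, hpi⟩ := IsHEdge.exists_mem_interior he
  refine ⟨(isHEdge_iff_isLEdge.1 he.1).2.swap, fun h => (h (a := p.swap) (by simpa using hp)).2 ?_⟩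
  rw [Rect.mem_interior_toSet] at hpi
  exact Rect.mem_interior_toSet.2 ⟨hpi.2, hpi.1⟩

lemma finite_isInteriorLEdge (T : TMesh) : {s | IsInteriorLEdge T s}.Finite := by
  refine (((finite_isHEdge T).image hSet).union
    ((finite_isHEdge T.swap).image fun e => Prod.swap ⁻¹' hSet e)).subset ?_
  rintro s ⟨hs, -⟩
  rcases hs.1 with ⟨a, b, y, hab, rfl⟩ | hv
  · exact Or.inl ⟨(a, b, y), isHEdge_iff_isLEdge.2 ⟨hab, hs⟩, rfl⟩
  · obtain ⟨a, b, y, hab, h⟩ := isHorizSeg_preimage_swap.2 hv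
    refine Or.inr ⟨(a, b, y), isHEdge_iff_isLEdge.2 ⟨hab, h ▸ hs.swap⟩, ?_⟩
    change Prod.swap ⁻¹' (Set.Icc a b ×ˢ {y}) = s
    rw [← h]
    rfl

lemma ncard_interiorHEdges_add_le (T : TMesh) :
    (interiorHEdges T).ncard + (interiorHEdges T.swap).ncard ≤ interiorLEdgeCount T := by
  have hinj : Set.InjOn hSet (interiorHEdges T) := fun e he e' he' h =>
    he.1.eq_of_hSet_eq he'.1 h
  have hinj' : Set.InjOn (fun e => Prod.swap ⁻¹' hSet e) (interiorHEdges T.swap) :=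
    fun e he e' he' h => he.1.eq_of_hSet_eq he'.1 (Prod.swap_surjective.preimage_injective h)
  rw [← hinj.ncard_image, ← hinj'.ncard_image,
    ← Set.ncard_union_eq _ ((finite_interiorHEdges T).image _)
      ((finite_interiorHEdges T.swap).image _)]
  · refine Set.ncard_le_ncard (Set.union_subset ?_ ?_) (finite_isInteriorLEdge T)
    · rintro _ ⟨e, he, rfl⟩
      exact isInteriorLEdge_hSet he
    · rintro _ ⟨e, he, rfl⟩
      exact isInteriorLEdge_preimage_hSet he
  · rw [Set.disjoint_left]
    rintro _ ⟨e, he, rfl⟩ ⟨e', he', h⟩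
    have h1 : (e.1, e.2.2) ∈ Prod.swap ⁻¹' hSet e' := by
      simp only at h
      rw [h]
      exact ⟨⟨le_rfl, he.1.1.le⟩, rfl⟩
    have h2 : (e.2.1, e.2.2) ∈ Prod.swap ⁻¹' hSet e' := by
      simp only at h
      rw [h]
      exact ⟨⟨he.1.1.le, le_rfl⟩, rfl⟩
    have h3 : e.1 = e'.2.2 := h1.2
    have h4 : e.2.1 = e'.2.2 := h2.2
    exact he.1.1.ne (h3.trans h4.symm)

/-! ### Counting vertices -/

/-- The right (`true`) or left (`false`) end point of a horizontal l-edge. -/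
def endPoint (e : ℝ × ℝ × ℝ) (b : Bool) : ℝ × ℝ := (if b then e.2.1 else e.1, e.2.2)

lemma IsHEdge.endPoint_mem {e : ℝ × ℝ × ℝ} (he : IsHEdge T e) (b : Bool) :
    (endPoint e b).1 ∈ Set.Icc e.1 e.2.1 := by
  cases b <;> simp [endPoint, he.1.le]

lemma IsHEdge.isVertexOf_endPoint {e : ℝ × ℝ × ℝ} (he : IsHEdge T e) (b : Bool) :
    IsVertexOf T (endPoint e b) := by
  cases b
  · exact he.isVertexOf_left
  · exact he.isVertexOf_right

lemma IsHEdge.endPoint_inj {e e' : ℝ × ℝ × ℝ} (he : IsHEdge T e) (he' : IsHEdge T e') {b b' : Bool}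
    (h : endPoint e b = endPoint e' b') : e = e' ∧ b = b' := by
  obtain rfl := he.eq_of_mem he' (Prod.ext_iff.1 h).2 (he.endPoint_mem b)
    (h ▸ he'.endPoint_mem b')
  have h1 := congrArg Prod.fst h
  cases b <;> cases b' <;> simp [endPoint, he.1.ne, he.1.ne'] at h1 ⊢

/-- Beyond an end point of a horizontal l-edge the adjacent cells have the end point in the
interior of one of their vertical sides. -/
lemma IsHEdge.exists_beyond {e : ℝ × ℝ × ℝ} (he : IsHEdge T e) (b : Bool)
    (h1 : T.outer.xmin < (endPoint e b).1) (h2 : (endPoint e b).1 < T.outer.xmax) :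
    ∃ t ∈ Set.Icc T.outer.xmin T.outer.xmax, ∀ c ∈ T.cells, t ∈ Set.Icc c.xmin c.xmax →
      (endPoint e b).1 ∈ Set.Icc c.xmin c.xmax ∧ e.2.2 ≠ c.ymin ∧ e.2.2 ≠ c.ymax := by
  have key (c : Rect) (hc : c ∈ T.cells) (hm : (endPoint e b).1 ∈ Set.Icc c.xmin c.xmax)
      (hlt : c.xmin < e.1 ∨ e.2.1 < c.xmax) : e.2.2 ≠ c.ymin ∧ e.2.2 ≠ c.ymax := by
    rw [← not_or]
    intro hy
    have hep := he.endPoint_mem b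
    have := he.eq_of_overlap (hSkel_of_cell hc hy) (hm.1.trans hep.2) (hep.1.trans hm.2)
    rcases hlt with h | h <;> linarith
  cases b
  · obtain ⟨t, ht, hta, htb⟩ := ((T.eventually_left (endPoint e false).1).and
      (Ioo_mem_nhdsLT h1)).exists
    refine ⟨t, ⟨hta.le, (htb.trans h2).le⟩, fun c hc htc => ?_⟩
    have hm : (endPoint e false).1 ∈ Set.Icc c.xmin c.xmax :=
      ⟨htc.1.trans htb.le, (ht c hc).2 htc.2⟩
    exact ⟨hm, key c hc hm (Or.inl (htc.1.trans_lt htb))⟩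
  · obtain ⟨t, ht, hta, htb⟩ := ((T.eventually_right (endPoint e true).1).and
      (Ioo_mem_nhdsGT h2)).exists
    refine ⟨t, ⟨(h1.trans hta).le, htb.le⟩, fun c hc htc => ?_⟩
    have hm : (endPoint e true).1 ∈ Set.Icc c.xmin c.xmax :=
      ⟨(ht c hc).1 htc.1, hta.le.trans htc.2⟩
    exact ⟨hm, key c hc hm (Or.inr (hta.trans_le htc.2))⟩

/-- In the interior no horizontal and vertical l-edge end at the same point. -/
lemma endPoint_ne_swap_endPoint {e e' : ℝ × ℝ × ℝ} (he : e ∈ interiorHEdges T)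
    (he' : e' ∈ interiorHEdges T.swap) (b b' : Bool) :
    endPoint e b ≠ (endPoint e' b').swap := by
  intro h
  have hx : (endPoint e b).1 = e'.2.2 := congrArg Prod.fst h
  have hy : e.2.2 = (endPoint e' b').1 := congrArg Prod.snd h
  obtain ⟨t, ht, htc⟩ := he.1.exists_beyond b (hx ▸ he'.2.1) (hx ▸ he'.2.2)
  obtain ⟨s, hs, hsc⟩ := he'.1.exists_beyond b' (hy ▸ he.2.1) (hy ▸ he.2.2)
  obtain ⟨c, hc, hp⟩ := T.exists_cell (p := (t, s)) ⟨ht, hs⟩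
  have h1 := htc c hc hp.1
  have h2 := hsc c.swap hc hp.2
  refine T.interior_cell_disjoint_skeleton hc (p := endPoint e b) (Rect.mem_interior_toSet.2 ?_)
    (he.1.2.1 _ (he.1.endPoint_mem b))
  rw [← hy] at h2
  rw [← hx] at h2
  have h3 : e.2.2 ∈ Set.Icc c.ymin c.ymax ∧ (endPoint e b).1 ≠ c.xmin ∧
    (endPoint e b).1 ≠ c.xmax := h2
  change (_ ∧ _) ∧ (_ < e.2.2 ∧ e.2.2 < _)
  simp only [Set.mem_Icc] at h1 h3
  grind

lemma IsCrossingVertex.exists_hSkel {p : ℝ × ℝ} (hp : IsCrossingVertex T p) :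
    ∃ ε > 0, HSkel T (p.1 - ε) (p.1 + ε) p.2 ∧ HSkel T.swap (p.2 - ε) (p.2 + ε) p.1 := by
  obtain ⟨-, -, ε, hε, h1, h2, h3, h4⟩ := hp
  refine ⟨ε, hε, fun x hx => ?_, fun y hy => TMesh.mem_skeleton_swap.2 ?_⟩
  · rcases le_total p.1 x with h | h
    · refine h1 ?_
      have : p + (ε, 0) = (p.1 + ε, p.2) := by ext <;> simp
      rw [this, ← Prod.mk.eta (p := p), ← Prod.image_mk_segment_left,
        segment_eq_Icc (by simp [hε.le])]
      exact ⟨x, ⟨h, hx.2⟩, rfl⟩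
    · refine h2 ?_
      have : p - (ε, 0) = (p.1 - ε, p.2) := by ext <;> simp
      rw [this, segment_symm, ← Prod.mk.eta (p := p), ← Prod.image_mk_segment_left,
        segment_eq_Icc (by simp [hε.le])]
      exact ⟨x, ⟨hx.1, h⟩, rfl⟩
  · rcases le_total p.2 y with h | h
    · refine h3 ?_
      have : p + (0, ε) = (p.1, p.2 + ε) := by ext <;> simp
      rw [this, ← Prod.mk.eta (p := p), ← Prod.image_mk_segment_right,
        segment_eq_Icc (by simp [hε.le])]
      exact ⟨y, ⟨h, hy.2⟩, rfl⟩
    · refine h4 ?_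
      have : p - (0, ε) = (p.1, p.2 - ε) := by ext <;> simp
      rw [this, segment_symm, ← Prod.mk.eta (p := p), ← Prod.image_mk_segment_right,
        segment_eq_Icc (by simp [hε.le])]
      exact ⟨y, ⟨hy.1, h⟩, rfl⟩

lemma IsHEdge.endPoint_ne_of_hSkel {e : ℝ × ℝ × ℝ} (he : IsHEdge T e) (b : Bool) {x ε : ℝ}
    (hε : 0 < ε) (h : HSkel T (x - ε) (x + ε) e.2.2) : x ≠ (endPoint e b).1 := by
  rintro rfl
  have hm := he.endPoint_mem b
  have := he.eq_of_overlap h (by linarith [hm.2]) (by linarith [hm.1])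
  cases b <;> simp [endPoint] at this <;> linarith

lemma IsCrossingVertex.ne_endPoint {p : ℝ × ℝ} (hp : IsCrossingVertex T p) {e : ℝ × ℝ × ℝ}
    (he : IsHEdge T e) (b : Bool) : p ≠ endPoint e b := by
  rintro rfl
  obtain ⟨ε, hε, h, -⟩ := hp.exists_hSkel
  exact he.endPoint_ne_of_hSkel b hε h rfl

lemma IsCrossingVertex.ne_swap_endPoint {p : ℝ × ℝ} (hp : IsCrossingVertex T p) {e : ℝ × ℝ × ℝ}
    (he : IsHEdge T.swap e) (b : Bool) : p ≠ (endPoint e b).swap := by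
  rintro rfl
  obtain ⟨ε, hε, -, h⟩ := hp.exists_hSkel
  exact he.endPoint_ne_of_hSkel b hε h rfl

lemma IsCrossingVertex.bounds {p : ℝ × ℝ} (hp : IsCrossingVertex T p) :
    (T.outer.xmin < p.1 ∧ p.1 < T.outer.xmax) ∧ (T.outer.ymin < p.2 ∧ p.2 < T.outer.ymax) :=
  Rect.mem_interior_toSet.1 hp.2.1

/-- A corner of the mesh. -/
def cornerPoint (T : TMesh) (q : Bool × Bool) : ℝ × ℝ :=
  (if q.1 then T.outer.xmax else T.outer.xmin, if q.2 then T.outer.ymax else T.outer.ymin)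

lemma cornerPoint_snd (T : TMesh) (q : Bool × Bool) :
    (cornerPoint T q).2 = T.outer.ymin ∨ (cornerPoint T q).2 = T.outer.ymax := by
  rcases q with ⟨_, _ | _⟩ <;> simp [cornerPoint]

lemma cornerPoint_fst (T : TMesh) (q : Bool × Bool) :
    (cornerPoint T q).1 = T.outer.xmin ∨ (cornerPoint T q).1 = T.outer.xmax := by
  rcases q with ⟨_ | _, _⟩ <;> simp [cornerPoint]

lemma cornerPoint_injective (T : TMesh) : Function.Injective (cornerPoint T) := by
  have hx := T.outer.hx.ne
  have hy := T.outer.hy.ne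
  rintro ⟨_ | _, _ | _⟩ ⟨_ | _, _ | _⟩ h <;> simp_all [cornerPoint]

lemma crossingCount_add_le (T : TMesh) :
    crossingCount T + 2 * ((interiorHEdges T).ncard + (interiorHEdges T.swap).ncard) + 4 ≤
      {p | IsVertexOf T p}.ncard := by
  have : Finite {p // IsCrossingVertex T p} := (finite_isVertexOf T).subset fun p hp => hp.1
  have : Finite {p // IsVertexOf T p} := finite_isVertexOf T
  have : Finite (interiorHEdges T) := finite_interiorHEdges T
  have : Finite (interiorHEdges T.swap) := finite_interiorHEdges T.swap
  let φ : {p // IsCrossingVertex T p} ⊕ (interiorHEdges T × Bool) ⊕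
      (interiorHEdges T.swap × Bool) ⊕ (Bool × Bool) → ℝ × ℝ :=
    Sum.elim Subtype.val (Sum.elim (fun q => endPoint q.1 q.2)
      (Sum.elim (fun q => (endPoint q.1 q.2).swap) (cornerPoint T)))
  have hφ : Function.Injective φ := by
    refine Subtype.val_injective.sumElim (Function.Injective.sumElim ?_
      (Function.Injective.sumElim ?_ (cornerPoint_injective T) ?_) ?_) ?_
    · rintro ⟨⟨e, he⟩, b⟩ ⟨⟨e', he'⟩, b'⟩ h
      obtain ⟨rfl, rfl⟩ := he.1.endPoint_inj he'.1 h
      rfl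
    · rintro ⟨⟨e, he⟩, b⟩ ⟨⟨e', he'⟩, b'⟩ h
      obtain ⟨rfl, rfl⟩ := he.1.endPoint_inj he'.1 (Prod.swap_injective h)
      rfl
    · rintro ⟨⟨e, he⟩, b⟩ q h
      have h1 : e.2.2 = (cornerPoint T q).1 := congrArg Prod.fst h
      rcases cornerPoint_fst T q with h2 | h2
      · exact he.2.1.ne' (h1.trans h2)
      · exact he.2.2.ne (h1.trans h2)
    · rintro ⟨⟨e, he⟩, b⟩ (⟨⟨e', he'⟩, b'⟩ | q) h
      · exact endPoint_ne_swap_endPoint he he' b b' h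
      · have h1 : e.2.2 = (cornerPoint T q).2 := (Prod.ext_iff.1 h).2
        rcases cornerPoint_snd T q with h2 | h2
        · exact he.2.1.ne' (h1.trans h2)
        · exact he.2.2.ne (h1.trans h2)
    · rintro ⟨p, hp⟩ (⟨⟨e, he⟩, b⟩ | ⟨⟨e, he⟩, b⟩ | q) h
      · exact hp.ne_endPoint he.1 b h
      · exact hp.ne_swap_endPoint he.1 b h
      · have h1 : p.2 = (cornerPoint T q).2 := congrArg Prod.snd h
        rcases cornerPoint_snd T q with h2 | h2
        · exact hp.bounds.2.1.ne' (h1.trans h2)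
        · exact hp.bounds.2.2.ne (h1.trans h2)
  have hmem (z) : IsVertexOf T (φ z) := by
    rcases z with ⟨p, hp⟩ | ⟨⟨e, he⟩, b⟩ | ⟨⟨e, he⟩, b⟩ | q
    · exact hp.1
    · exact he.1.isVertexOf_endPoint b
    · exact isVertexOf_swap.1 (he.1.isVertexOf_endPoint b)
    · exact isVertexOf_corner T (cornerPoint_fst T q) (cornerPoint_snd T q)
  have hle := Nat.card_le_card_of_injective
    (fun z => (⟨φ z, hmem z⟩ : {p // IsVertexOf T p})) fun z z' h => hφ (congrArg Subtype.val h)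
  rw [Nat.card_sum, Nat.card_sum, Nat.card_sum, Nat.card_prod, Nat.card_prod, Nat.card_prod,
    Nat.card_eq_fintype_card (α := Bool), Fintype.card_bool] at hle
  simp only [Nat.card_coe_set_eq] at hle
  change crossingCount T + _ ≤ Set.ncard {p | IsVertexOf T p} at hle
  omega

end Count

/-- **Theorem 4.4 (lower bound).** For a regular T-mesh with `V⁺ > 0` crossing vertices and
`E` interior l-edges, `dim S̄(2,2,1,1,T) ≥ V⁺ − E + 1`. -/
theorem dim_SBar2211_lower_bound (T : TMesh) (hV : 0 < crossingCount T) :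
    ∃ d : ℕ, DimGE (SBar 2 2 1 1 T) d ∧
      (crossingCount T : ℤ) - (interiorLEdgeCount T : ℤ) + 1 ≤ (d : ℤ) := by
  have : Fintype {p // IsVertexOf T p} := (finite_isVertexOf T).fintype
  have : Fintype {e // IsHEdge T e} := (finite_isHEdge T).fintype
  have : Fintype {e // IsHEdge T.swap e} := (finite_isHEdge T.swap).fintype
  let P : {p // IsVertexOf T p} → ℝ × ℝ := Subtype.val
  choose e he hey hex using fun v : {p // IsVertexOf T p} => v.2.exists_isHEdge
  choose w hw hwx hwy using fun v : {p // IsVertexOf T p} =>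
    (isVertexOf_swap (p := v.1.swap).2 v.2).exists_isHEdge
  obtain ⟨p, hp⟩ : {p | IsCrossingVertex T p}.Nonempty :=
    Set.nonempty_of_ncard_ne_zero (Nat.pos_iff_ne_zero.1 hV)
  have hb := hp.bounds
  let e' (v : {p // IsVertexOf T p}) : {e // IsHEdge T e} := ⟨e v, he v⟩
  let w' (v : {p // IsVertexOf T p}) : {e // IsHEdge T.swap e} := ⟨w v, hw v⟩
  let l : Fin 3 → {e // IsHEdge T e} :=
    ![e' ⟨(T.outer.xmin, T.outer.ymin), isVertexOf_corner T (Or.inl rfl) (Or.inl rfl)⟩,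
      e' ⟨p, hp.1⟩,
      e' ⟨(T.outer.xmin, T.outer.ymax), isVertexOf_corner T (Or.inl rfl) (Or.inr rfl)⟩]
  have hl : Function.Injective fun m => (l m).1.2.2 := by
    refine StrictMono.injective (Fin.strictMono_iff_lt_succ.2 fun i => ?_)
    fin_cases i <;> simp [l, e', hey, hb]
  have hrank := card_add_nine_le_finrank_ker (fun v => (P v).1) (fun v => (P v).2) e' w'
    (fun a => a.1.2.2) (fun a => a.1.2.2) hey hwx l hl
  set K := LinearMap.ker ((momentMap e' fun v => (P v).1).prod (momentMap w' fun v => (P v).2))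
  refine ⟨Module.finrank ℝ K, ⟨fun i => truncSplineLinear P (Module.finBasis ℝ K i), fun i => ?_,
    ?_⟩, ?_⟩
  · obtain ⟨hc1, hc2⟩ := Prod.mk_eq_zero.1 (LinearMap.mem_ker.1 (Module.finBasis ℝ K i).2)
    refine truncSpline_mem_SBar ⟨e, fun v => ⟨he v, hey v, hex v⟩, fun ε k => ?_⟩
      ⟨w, fun v => ⟨hw v, hwx v, hwy v⟩, fun ε k => ?_⟩
    · by_cases hε : IsHEdge T ε
      · have := congrFun hc1 (⟨ε, hε⟩, k)
        simpa [momentMap, e', Subtype.ext_iff] using this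
      · refine Finset.sum_eq_zero fun v hv => absurd (he v) ?_
        rwa [(Finset.mem_filter.1 hv).2]
    · by_cases hε : IsHEdge T.swap ε
      · have := congrFun hc2 (⟨ε, hε⟩, k)
        simpa [momentMap, w', Subtype.ext_iff] using this
      · refine Finset.sum_eq_zero fun v hv => absurd (hw v) ?_
        rwa [(Finset.mem_filter.1 hv).2]
  · have hli := (Module.finBasis ℝ K).linearIndependent.map' K.subtype K.ker_subtype
    exact hli.map' (truncSplineLinear P)
      (LinearMap.ker_eq_bot.2 (truncSplineLinear_injective Subtype.val_injective))
  · have h1 := crossingCount_add_le T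
    have h2 := ncard_interiorHEdges_add_le T
    have h3 := ncard_isHEdge_le T
    have h4 := ncard_isHEdge_le T.swap
    simp only [← Nat.card_eq_fintype_card] at hrank
    change {p | IsVertexOf T p}.ncard + 9 ≤ _ +
      3 * ({e | IsHEdge T e}.ncard + {e | IsHEdge T.swap e}.ncard) at hrank
    omega
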